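/- arXiv:1502.02851 — 5 statements merged into one kernel-verified Lean document; each statement's English description precedes it below -/
import Mathlib

section
/- Theorem 1 (almost global asymptotic stability). Let k ≥ 1, let h : ℝ^k → ℝ^k be C¹, and suppose h generates a global flow Y : ℝ × ℝ^k → ℝ^k, i.e. Y(0,y) = y, ∂_t Y(t,y) = h(Y(t,y)) for all (t,y), and Y(t+s,y) = Y(t, Y(s,y)) for all t, s, y. Suppose there exist continuous, proper, positive definite functions U_ℓ, U_g : ℝ^k → [0,∞) that are locally Lipschitz on ℝ^k \ {0}, continuous positive definite functions E_ℓ, E_g : ℝ^k → [0,∞), and constants M̂_ℓ > 0 and M̃_g > 0 such that: (i) D⁺_h U_ℓ(y) ≤ −E_ℓ(y) for every y ≠ 0 with U_ℓ(y) ≤ M̂_ℓ; (ii) D⁺_h U_g(y) ≤ −E_g(y) for every y with U_g(y) ≥ M̃_g; (iii) Ω_{≤M̂_ℓ}(U_ℓ) is strictly contained in Ω_{≤M̃_g}(U_g). Let R := cl(Ω_{≤M̃_g}(U_g) \ Ω_{≤M̂_ℓ}(U_ℓ)). If there exists a nonnegative function ρ : ℝ^k → [0,∞) that is C¹ on ℝ^k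 \ {0}, whose support contains R, and such that div(y ↦ ρ(y)·h(y)) > 0 at every y ∈ R, then the origin is almost globally asymptotically stable for ẏ = h(y): the origin is Lyapunov stable (for every ε > 0 there exists δ > 0 such that |y| < δ implies |Y(t,y)| < ε for all t ≥ 0), and there exists a set ℵ ⊆ ℝ^k of Lebesgue measure zero such that Y(t,y) → 0 as t → ∞ for every y ∉ ℵ. -/
open Filter Topology Set

noncomputable section

/-- A function of class `K∞`: continuous, strictly increasing and vanishing at `0`
on `[0,∞)`, and tending to `∞`. -/
def ClassKInf (α : ℝ → ℝ) : Prop :=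
  ContinuousOn α (Set.Ici 0) ∧ StrictMonoOn α (Set.Ici 0) ∧ α 0 = 0 ∧
    Filter.Tendsto α Filter.atTop Filter.atTop

/-- Positive definite function. -/
def PosDefFun {E : Type*} [NormedAddCommGroup E] (U : E → ℝ) : Prop :=
  U 0 = 0 ∧ ∀ y : E, y ≠ 0 → 0 < U y

/-- Proper function: `U y → ∞` as `‖y‖ → ∞`. -/
def ProperFun {E : Type*} [NormedAddCommGroup E] (U : E → ℝ) : Prop :=
  ∀ C : ℝ, ∃ R : ℝ, ∀ y : E, R ≤ ‖y‖ → C ≤ U y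

/-- Storage function: locally Lipschitz, nonnegative and sandwiched between two
class `K∞` functions of the norm. -/
def IsStorage {E : Type*} [NormedAddCommGroup E] (V : E → ℝ) : Prop :=
  (∀ x, 0 ≤ V x) ∧ LocallyLipschitz V ∧
    ∃ a b : ℝ → ℝ, ClassKInf a ∧ ClassKInf b ∧ ∀ x : E, a ‖x‖ ≤ V x ∧ V x ≤ b ‖x‖

/-- Locally Lipschitz on a set. -/
def LocallyLipschitzOnSet {E F : Type*} [PseudoMetricSpace E] [PseudoMetricSpace F]
    (f : E → F) (s : Set E) : Prop :=
  ∀ y ∈ s, ∃ K : NNReal, ∃ t ∈ 𝓝[s] y, LipschitzOnWith K f t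

/-- Dini derivative of `U` in the direction `v` at the point `y`, with values in
the extended reals. -/
noncomputable def dini {E : Type*} [NormedAddCommGroup E] [NormedSpace ℝ E]
    (U : E → ℝ) (v : E) (y : E) : EReal :=
  Filter.limsup (fun τ : ℝ => (((U (y + τ • v) - U y) / τ : ℝ) : EReal)) (𝓝[>] (0:ℝ))

/-- Divergence of a vector field: trace of the Jacobian. -/
noncomputable def diverg {E : Type*} [NormedAddCommGroup E] [NormedSpace ℝ E]
    (F : E → E) (y : E) : ℝ :=
  LinearMap.trace ℝ E (fderiv ℝ F y : E →ₗ[ℝ] E)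

theorem aux_barrier {f B : ℝ → ℝ} {a b : ℝ} (hf : Continuous f) (hB : Continuous B)
    (ha : f a ≤ B a)
    (H : ∀ x, a ≤ x → f x = B x → ∀ᶠ z in 𝓝[>] x, f z ≤ B z) :
    ∀ x ∈ Icc a b, f x ≤ B x := by
  have hc : IsClosed ({x | f x ≤ B x} ∩ Icc a b) := (isClosed_le hf hB).inter isClosed_Icc
  refine fun x hx => hc.Icc_subset_of_forall_exists_gt ha ?_ hx
  rintro x ⟨hx1, hx2⟩ y hy
  have hx1' : f x ≤ B x := hx1
  have key : ∀ᶠ z in 𝓝[>] x, f z ≤ B z := by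
    rcases hx1'.lt_or_eq with hlt | heq
    · have : ∀ᶠ z in 𝓝 x, f z < B z := hf.continuousAt.eventually_lt hB.continuousAt hlt
      exact (this.filter_mono nhdsWithin_le_nhds).mono fun z hz => hz.le
    · exact H x hx2.1 heq
  have h2 : ∀ᶠ z in 𝓝[>] x, z ∈ Ioc x y := Ioc_mem_nhdsGT hy
  obtain ⟨z, hz1, hz2⟩ := (key.and h2).exists
  exact ⟨z, hz1, hz2⟩

theorem aux_dini {E : Type*} [NormedAddCommGroup E] [NormedSpace ℝ E]
    {U : E → ℝ} (hU : LocallyLipschitzOnSet U ({(0:E)}ᶜ : Set E))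
    {x : ℝ → E} {v : E} {t e r : ℝ} (hx : HasDerivAt x v t) (hx0 : x t ≠ 0)
    (hd : dini U v (x t) ≤ ((-e : ℝ) : EReal)) (hr : -e < r) :
    ∀ᶠ z in 𝓝[>] t, U (x z) ≤ U (x t) + r * (z - t) := by
  obtain ⟨r', hr1, hr2⟩ := exists_between hr
  have h1 : dini U v (x t) < ((r' : ℝ) : EReal) := lt_of_le_of_lt hd (by exact_mod_cast hr1)
  have h2 := Filter.eventually_lt_of_limsup_lt h1
  have hT : Tendsto (fun z : ℝ => z - t) (𝓝[>] t) (𝓝[>] 0) := by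
    refine tendsto_nhdsWithin_iff.2 ⟨?_, ?_⟩
    · have : Tendsto (fun z : ℝ => z - t) (𝓝 t) (𝓝 (t - t)) := by
        exact (continuous_id.sub continuous_const).continuousAt
      rw [sub_self] at this
      exact this.mono_left nhdsWithin_le_nhds
    · filter_upwards [self_mem_nhdsWithin] with z hz
      simpa using hz
  have h3 := hT.eventually h2
  obtain ⟨K, s, hs, hK⟩ := hU (x t) (by simpa using hx0)
  have hs' : s ∈ 𝓝 (x t) := by
    rwa [IsOpen.nhdsWithin_eq isOpen_compl_singleton (by simpa using hx0)] at hs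
  have h4 : ∀ᶠ z in 𝓝[>] t, x z ∈ s :=
    (hx.continuousAt.eventually hs').filter_mono nhdsWithin_le_nhds
  have h5 : ∀ᶠ z in 𝓝[>] t, x t + (z - t) • v ∈ s := by
    have : Tendsto (fun z : ℝ => x t + (z - t) • v) (𝓝 t) (𝓝 (x t + (t - t) • v)) := by
      apply Continuous.tendsto; fun_prop
    rw [sub_self, zero_smul, add_zero] at this
    exact (this.eventually hs').filter_mono nhdsWithin_le_nhds
  have hε : 0 < (r - r') / (K + 1) := by
    have : (0:ℝ) ≤ K := K.2
    exact div_pos (by linarith) (by linarith)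
  have h6 := ((hasDerivAt_iff_isLittleO.1 hx).bound hε).filter_mono
    (nhdsWithin_le_nhds (s := Ioi t))
  filter_upwards [h3, h4, h5, h6, self_mem_nhdsWithin] with z k3 k4 k5 k6 hz
  have hz' : 0 < z - t := by simpa using hz
  have k3' : (U (x t + (z - t) • v) - U (x t)) / (z - t) < r' := by exact_mod_cast k3
  rw [div_lt_iff₀ hz'] at k3'
  have k7 := hK.dist_le_mul _ k4 _ k5
  rw [Real.dist_eq, dist_eq_norm] at k7
  have k8 : x z - (x t + (z - t) • v) = x z - x t - (z - t) • v := by abel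
  rw [k8] at k7
  rw [Real.norm_of_nonneg hz'.le] at k6
  have hK0 : (0:ℝ) ≤ K := K.2
  have k9 : (K:ℝ) * ‖x z - x t - (z - t) • v‖ ≤ (r - r') * (z - t) := by
    calc (K:ℝ) * ‖x z - x t - (z - t) • v‖ ≤ (K + 1) * ((r - r') / (K + 1) * (z - t)) := by
          apply mul_le_mul (by linarith) k6 (norm_nonneg _) (by linarith)
      _ = (r - r') * (z - t) := by field_simp
  have := le_abs_self (U (x z) - U (x t + (z - t) • v))
  nlinarith

theorem aux_proper_compact {E : Type*} [NormedAddCommGroup E] [ProperSpace E]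
    {U : E → ℝ} (hUc : Continuous U) (hUp : ProperFun U) (c : ℝ) : IsCompact {y | U y ≤ c} := by
  obtain ⟨R, hR⟩ := hUp (c + 1)
  refine (isCompact_closedBall (0:E) R).of_isClosed_subset (isClosed_le hUc continuous_const) ?_
  intro y hy
  have hy' : U y ≤ c := hy
  rw [mem_closedBall_zero_iff]
  by_contra hcon
  have := hR y (not_le.1 hcon).le
  linarith

theorem aux_reach {E : Type*} [NormedAddCommGroup E] [NormedSpace ℝ E] [ProperSpace E]
    {h : E → E} {Y : ℝ → E → E} (hY0 : ∀ y, Y 0 y = y)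
    (hYd : ∀ (t : ℝ) (y : E), HasDerivAt (fun s => Y s y) (h (Y t y)) t)
    {U W : E → ℝ} (hUc : Continuous U) (hUp : ProperFun U) (hU0 : U 0 = 0)
    (hUl : LocallyLipschitzOnSet U ({(0:E)}ᶜ : Set E))
    (hWc : Continuous W) (hW : PosDefFun W) {lo hi : ℝ} (hlo : 0 < lo) (hlohi : lo ≤ hi)
    (hd : ∀ y, lo ≤ U y → U y ≤ hi → dini U (h y) y ≤ ((-(W y) : ℝ) : EReal)) :
    ∃ m > 0, ∀ y, U y ≤ hi → ∀ t, 0 ≤ t → U (Y t y) ≤ max lo (hi - m * t) := by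
  have hK : IsCompact {y | lo ≤ U y ∧ U y ≤ hi} := by
    have := (aux_proper_compact hUc hUp hi).inter_left (isClosed_le continuous_const hUc : IsClosed {y | lo ≤ U y})
    exact this
  have hne : ∀ y, lo ≤ U y → y ≠ 0 := by
    rintro y hy rfl
    linarith
  obtain ⟨m, hm, hmW⟩ : ∃ m > 0, ∀ y, lo ≤ U y → U y ≤ hi → m ≤ W y := by
    rcases (Set.eq_empty_or_nonempty {y | lo ≤ U y ∧ U y ≤ hi}) with he | he
    · refine ⟨1, one_pos, fun y h1 h2 => ?_⟩
      have : y ∈ {y | lo ≤ U y ∧ U y ≤ hi} := ⟨h1, h2⟩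
      rw [he] at this
      exact this.elim
    · obtain ⟨y, hy, hmin⟩ := hK.exists_isMinOn he hWc.continuousOn
      exact ⟨W y, hW.2 y (hne y hy.1), fun z h1 h2 => hmin ⟨h1, h2⟩⟩
  refine ⟨m / 2, by positivity, fun y hy t ht => ?_⟩
  have hfc : Continuous fun t => U (Y t y) :=
    hUc.comp (continuous_iff_continuousAt.2 fun s => (hYd s y).continuousAt)
  refine aux_barrier (f := fun t => U (Y t y)) (B := fun t => max lo (hi - m / 2 * t)) (a := 0)
    (b := t) hfc (by fun_prop) ?_ ?_ t ⟨ht, le_rfl⟩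
  · simp [hY0, hy]
  · intro x hx heq
    have heq' : U (Y x y) = max lo (hi - m / 2 * x) := heq
    have l1 : lo ≤ U (Y x y) := by rw [heq']; exact le_max_left _ _
    have l2 : U (Y x y) ≤ hi := by
      rw [heq']; apply max_le hlohi; nlinarith
    have := aux_dini hUl (hYd x y) (hne _ l1) (hd _ l1 l2) (r := -(m/2))
      (by have := hmW _ l1 l2; linarith)
    filter_upwards [this, self_mem_nhdsWithin] with z hz hzx
    have hzx' : x < z := hzx
    rw [heq'] at hz
    refine hz.trans ?_
    rcases le_total lo (hi - m / 2 * x) with hc | hc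
    · rw [max_eq_right hc]
      exact le_trans (by linarith) (le_max_right _ _)
    · rw [max_eq_left hc]
      exact le_trans (by nlinarith) (le_max_left _ _)

theorem aux_small {E : Type*} [NormedAddCommGroup E] [ProperSpace E]
    {U : E → ℝ} (hUc : Continuous U) (hUp : ProperFun U) (hU : PosDefFun U)
    {M : ℝ} (hM : 0 < M) {ε : ℝ} (hε : 0 < ε) :
    ∃ c > 0, c ≤ M ∧ ∀ y, U y ≤ c → ‖y‖ < ε := by
  have hK : IsCompact ({y | ε ≤ ‖y‖} ∩ {y | U y ≤ M}) :=
    (aux_proper_compact hUc hUp M).inter_left (isClosed_le continuous_const continuous_norm)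
  rcases (Set.eq_empty_or_nonempty ({y | ε ≤ ‖y‖} ∩ {y | U y ≤ M})) with he | he
  · refine ⟨M, hM, le_rfl, fun y hy => ?_⟩
    by_contra hcon
    have : y ∈ ({y | ε ≤ ‖y‖} ∩ {y | U y ≤ M}) := ⟨not_lt.1 hcon, hy⟩
    rw [he] at this
    exact this.elim
  · obtain ⟨y, hy, hmin⟩ := hK.exists_isMinOn he hUc.continuousOn
    have hy0 : y ≠ 0 := by
      rintro rfl
      have : ε ≤ ‖(0:E)‖ := hy.1
      simp at this; linarith
    have hp := hU.2 y hy0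
    refine ⟨min M (U y / 2), by positivity, min_le_left _ _, fun z hz => ?_⟩
    by_contra hcon
    have : U y ≤ U z := hmin ⟨not_lt.1 hcon, hz.trans (min_le_left _ _)⟩
    have := hz.trans (min_le_right _ _)
    linarith

theorem aux_lip1 {E : Type*} [NormedAddCommGroup E] [NormedSpace ℝ E]
    {h : E → E} {Y : ℝ → E → E} (hY0 : ∀ y, Y 0 y = y)
    (hYd : ∀ (t : ℝ) (y : E), HasDerivAt (fun s => Y s y) (h (Y t y)) t)
    {K : NNReal} {r T : ℝ} (hK : LipschitzOnWith K h (Metric.closedBall 0 (r + 1/2)))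
    {y z : E} (hz : ∀ s ∈ Icc 0 T, Y s z ∈ Metric.closedBall 0 r)
    (hyz : ‖y - z‖ * Real.exp ((K + 1) * T) ≤ 1 / 2) :
    ∀ s ∈ Icc 0 T, ‖Y s y - Y s z‖ ≤ ‖y - z‖ * Real.exp ((K + 1) * s) := by
  intro s hs
  rcases eq_or_ne y z with rfl | hne
  · simp
  have hpos : 0 < ‖y - z‖ := norm_pos_iff.2 (sub_ne_zero.2 hne)
  have hd : ∀ x, HasDerivAt (fun s => Y s y - Y s z) (h (Y x y) - h (Y x z)) x :=
    fun x => (hYd x y).sub (hYd x z)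
  refine image_norm_le_of_norm_deriv_right_lt_deriv_boundary (a := 0) (b := T)
    (f := fun s => Y s y - Y s z) (f' := fun s => h (Y s y) - h (Y s z))
    (B := fun s => ‖y - z‖ * Real.exp ((K + 1) * s))
    (B' := fun s => ‖y - z‖ * (Real.exp ((K + 1) * s) * ((K + 1) * 1)))
    (fun x _ => (hd x).continuousAt.continuousWithinAt)
    (fun x _ => (hd x).hasDerivWithinAt) ?_ ?_ ?_ hs
  · simp [hY0]
  · intro x
    exact (((hasDerivAt_id x).const_mul _).exp).const_mul _
  · intro x hx heq
    have hx' : x ∈ Icc 0 T := ⟨hx.1, hx.2.le⟩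
    have heq' : ‖Y x y - Y x z‖ = ‖y - z‖ * Real.exp ((K + 1) * x) := heq
    have hKn : (0:ℝ) ≤ K := K.2
    have hle : ‖Y x y - Y x z‖ ≤ 1/2 := by
      rw [heq']
      refine le_trans ?_ hyz
      gcongr
      exact hx.2.le
    have hzx := hz x hx'
    rw [mem_closedBall_zero_iff] at hzx
    have m1 : Y x z ∈ Metric.closedBall (0:E) (r + 1/2) := by
      rw [mem_closedBall_zero_iff]; linarith
    have m2 : Y x y ∈ Metric.closedBall (0:E) (r + 1/2) := by
      rw [mem_closedBall_zero_iff]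
      have := norm_add_le (Y x y - Y x z) (Y x z)
      rw [sub_add_cancel] at this
      linarith
    have := hK.dist_le_mul _ m2 _ m1
    rw [dist_eq_norm, dist_eq_norm, heq'] at this
    have he : 0 < ‖y - z‖ * Real.exp ((K + 1) * x) := by positivity
    refine lt_of_le_of_lt this ?_
    nlinarith

theorem aux_flowlip {E : Type*} [NormedAddCommGroup E] [NormedSpace ℝ E] [ProperSpace E]
    {h : E → E} (hh : ContDiff ℝ 1 h) {Y : ℝ → E → E} (hY0 : ∀ y, Y 0 y = y)
    (hYd : ∀ (t : ℝ) (y : E), HasDerivAt (fun s => Y s y) (h (Y t y)) t)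
    (T : ℝ) (y0 : E) :
    ∃ δ > 0, ∃ C : NNReal, ∀ t ∈ Icc 0 T, LipschitzOnWith C (Y t) (Metric.ball y0 δ) := by
  have hc : Continuous fun s => Y s y0 :=
    continuous_iff_continuousAt.2 fun s => (hYd s y0).continuousAt
  obtain ⟨r, hr⟩ := ((isCompact_Icc (a := (0:ℝ)) (b := T)).image hc).isBounded.subset_closedBall 0
  obtain ⟨K, hK⟩ : ∃ K : NNReal, LipschitzOnWith K h (Metric.closedBall 0 (r + 1)) := by
    obtain ⟨C, hC⟩ := (isCompact_closedBall (0:E) (r+1)).exists_bound_of_continuousOn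
      (hh.continuous_fderiv one_ne_zero).continuousOn
    refine ⟨Real.toNNReal C, (convex_closedBall _ _).lipschitzOnWith_of_nnnorm_fderiv_le
      (𝕜 := ℝ) (fun x _ => hh.differentiable one_ne_zero x) (fun x hx => ?_)⟩
    rw [← NNReal.coe_le_coe, coe_nnnorm]
    exact (hC x hx).trans (Real.le_coe_toNNReal C)
  set e := Real.exp ((K + 1) * T) with he
  have hepos : 0 < e := Real.exp_pos _
  have hKn : (0:ℝ) ≤ K := K.2
  refine ⟨1 / (4 * e), by positivity, Real.toNNReal e, fun t ht => ?_⟩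
  have step1 : ∀ y ∈ Metric.ball y0 (1 / (4 * e)), ∀ s ∈ Icc 0 T,
      Y s y ∈ Metric.closedBall 0 (r + 1/2) := by
    intro y hy s hs
    rw [Metric.mem_ball, dist_eq_norm, lt_div_iff₀ (by positivity)] at hy
    have hK' : LipschitzOnWith K h (Metric.closedBall 0 (r + 1/2)) :=
      hK.mono (Metric.closedBall_subset_closedBall (by linarith))
    have h0 : ∀ s ∈ Icc 0 T, Y s y0 ∈ Metric.closedBall 0 r :=
      fun s hs => hr (mem_image_of_mem _ hs)
    have h1 := aux_lip1 hY0 hYd hK' h0 (y := y) (by rw [← he]; linarith) s hs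
    have h2 : ‖y - y0‖ * Real.exp ((K + 1) * s) ≤ ‖y - y0‖ * e := by
      rw [he]; gcongr; exact hs.2
    have h3 := h0 s hs
    rw [mem_closedBall_zero_iff] at h3 ⊢
    have := norm_add_le (Y s y - Y s y0) (Y s y0)
    rw [sub_add_cancel] at this
    linarith
  refine LipschitzOnWith.of_dist_le_mul fun y hy z hz => ?_
  have hK' : LipschitzOnWith K h (Metric.closedBall 0 ((r + 1/2) + 1/2)) := by
    convert hK using 2; ring
  have hyz : ‖y - z‖ * e ≤ 1 / 2 := by
    rw [Metric.mem_ball, dist_eq_norm, lt_div_iff₀ (by positivity)] at hy hz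
    have : ‖y - z‖ ≤ ‖y - y0‖ + ‖z - y0‖ := by
      rw [← sub_sub_sub_cancel_right y z y0]; exact norm_sub_le _ _
    nlinarith
  have := aux_lip1 hY0 hYd hK' (step1 z hz) (y := y) hyz t ht
  rw [dist_eq_norm, dist_eq_norm, Real.coe_toNNReal _ hepos.le, mul_comm]
  refine this.trans ?_
  rw [he]; gcongr; exact ht.2

theorem aux_near {E : Type*} [NormedAddCommGroup E] [NormedSpace ℝ E] [ProperSpace E]
    {h : E → E} (hh : ContDiff ℝ 1 h) {Y : ℝ → E → E} (hY0 : ∀ y, Y 0 y = y)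
    (hYd : ∀ (t : ℝ) (y : E), HasDerivAt (fun s => Y s y) (h (Y t y)) t)
    (y0 : E) {η : ℝ} (hη : 0 < η) :
    ∃ δ > 0, ∀ t ∈ Icc 0 δ, ∀ y ∈ Metric.ball y0 δ, Y t y ∈ Metric.ball y0 η := by
  obtain ⟨δ, hδ, C, hC⟩ := aux_flowlip hh hY0 hYd 1 y0
  have hcont : ContinuousAt (fun s => Y s y0) 0 := (hYd 0 y0).continuousAt
  obtain ⟨d, hd, hd'⟩ := Metric.continuousAt_iff.1 hcont (η / 2) (by positivity)
  have hCn : (0:ℝ) ≤ C := C.2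
  have hq : 0 < η / (2 * (C + 1)) := by positivity
  refine ⟨min (min δ (d / 2)) (min 1 (η / (2 * (C + 1)))), by positivity, fun t ht y hy => ?_⟩
  have t1 : t ≤ 1 := ht.2.trans ((min_le_right _ _).trans (min_le_left _ _))
  have t2 : t < d := lt_of_le_of_lt (ht.2.trans ((min_le_left _ _).trans (min_le_right _ _)))
    (by linarith)
  have y1 : y ∈ Metric.ball y0 δ :=
    Metric.ball_subset_ball ((min_le_left _ _).trans (min_le_left _ _)) hy
  have y2 : dist y y0 < η / (2 * (C + 1)) :=
    lt_of_lt_of_le hy ((min_le_right _ _).trans (min_le_right _ _))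
  have h1 := (hC t ⟨ht.1, t1⟩).dist_le_mul y y1 y0 (Metric.mem_ball_self hδ)
  have h2 : dist (Y t y0) (Y 0 y0) < η / 2 := hd' (by
    rw [Real.dist_eq, sub_zero, abs_of_nonneg ht.1]; exact t2)
  rw [hY0] at h2
  rw [lt_div_iff₀ (by positivity)] at y2
  have h3 := dist_triangle (Y t y) (Y t y0) y0
  rw [Metric.mem_ball]
  have := dist_nonneg (x := y) (y := y0)
  nlinarith

theorem aux_move {E : Type*} [NormedAddCommGroup E] [NormedSpace ℝ E] [ProperSpace E]
    {h : E → E} (hh : ContDiff ℝ 1 h) {Y : ℝ → E → E} (hY0 : ∀ y, Y 0 y = y)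
    (hYd : ∀ (t : ℝ) (y : E), HasDerivAt (fun s => Y s y) (h (Y t y)) t)
    (y0 : E) {ε : ℝ} (hε : 0 < ε) :
    ∃ δ > 0, ∀ t ∈ Icc 0 δ, ∀ y ∈ Metric.ball y0 δ, ‖Y t y - y - t • h y0‖ ≤ ε * t := by
  obtain ⟨η, hη, hη'⟩ := Metric.continuousAt_iff.1 (hh.continuous.continuousAt (x := y0)) ε hε
  obtain ⟨δ, hδ, H⟩ := aux_near hh hY0 hYd y0 hη
  refine ⟨δ, hδ, fun t ht y hy => ?_⟩
  have hd : ∀ x, HasDerivAt (fun s => Y s y - s • h y0) (h (Y x y) - (1:ℝ) • h y0) x :=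
    fun x => (hYd x y).sub ((hasDerivAt_id x).smul_const _)
  have := norm_image_sub_le_of_norm_deriv_le_segment' (a := 0) (b := t) (C := ε)
    (f := fun s => Y s y - s • h y0) (f' := fun s => h (Y s y) - (1:ℝ) • h y0)
    (fun x _ => (hd x).hasDerivWithinAt) (fun x hx => ?_) t ⟨ht.1, le_rfl⟩
  · simp only [hY0, zero_smul, sub_zero] at this
    convert this using 2
    abel
  · have := hη' (H x ⟨hx.1, hx.2.le.trans ht.2⟩ y hy)
    rw [one_smul, ← dist_eq_norm]
    exact this.le

theorem aux_expand {E : Type*} [NormedAddCommGroup E] [NormedSpace ℝ E] [ProperSpace E]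
    {h : E → E} (hh : ContDiff ℝ 1 h) {Y : ℝ → E → E} (hY0 : ∀ y, Y 0 y = y)
    (hYd : ∀ (t : ℝ) (y : E), HasDerivAt (fun s => Y s y) (h (Y t y)) t)
    (y0 : E) {ε : ℝ} (hε : 0 < ε) :
    ∃ δ > 0, ∀ t ∈ Icc 0 δ, ∀ y ∈ Metric.ball y0 δ, ∀ z ∈ Metric.ball y0 δ,
      ‖Y t y - Y t z - (y - z) - t • fderiv ℝ h y0 (y - z)‖ ≤ ε * ‖y - z‖ * t := by
  obtain ⟨δ1, hδ1, C, hC⟩ := aux_flowlip hh hY0 hYd 1 y0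
  set A := fderiv ℝ h y0 with hA
  have hCn : (0:ℝ) ≤ C := C.2
  set ε' := ε / (2 * (C + 1)) with hε'
  have hε'p : 0 < ε' := by positivity
  have hst : HasStrictFDerivAt h A y0 := hh.contDiffAt.hasStrictFDerivAt one_ne_zero
  obtain ⟨η, hη, hη'⟩ : ∃ η > 0, ∀ a ∈ Metric.ball y0 η, ∀ b ∈ Metric.ball y0 η,
      ‖h a - h b - A (a - b)‖ ≤ ε' * ‖a - b‖ := by
    have := hst.isLittleO.bound hε'p
    rw [nhds_prod_eq, Metric.nhds_basis_ball.prod_self.eventually_iff] at this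
    obtain ⟨η, hη, H⟩ := this
    exact ⟨η, hη, fun a ha b hb => H (show (a, b) ∈ _ from ⟨ha, hb⟩)⟩
  obtain ⟨δ2, hδ2, H⟩ := aux_near hh hY0 hYd y0 hη
  set L := ‖A‖ * ((‖A‖ + ε') * C) with hL
  have hLn : 0 ≤ L := by positivity
  refine ⟨min (min δ1 δ2) (min 1 (ε / (2 * (L + 1)))), by positivity, fun t ht y hy z hz => ?_⟩
  have ht1 : t ≤ 1 := ht.2.trans ((min_le_right _ _).trans (min_le_left _ _))
  have ht2 : t ≤ δ2 := ht.2.trans ((min_le_left _ _).trans (min_le_right _ _))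
  have ht3 : t ≤ ε / (2 * (L + 1)) := ht.2.trans ((min_le_right _ _).trans (min_le_right _ _))
  have b1 := Metric.ball_subset_ball (x := y0)
    ((min_le_left (min δ1 δ2) (min 1 (ε / (2 * (L + 1))))).trans (min_le_left _ _))
  have b2 := Metric.ball_subset_ball (x := y0)
    ((min_le_left (min δ1 δ2) (min 1 (ε / (2 * (L + 1))))).trans (min_le_right _ _))
  have w1 : ∀ s ∈ Icc 0 t, ‖Y s y - Y s z‖ ≤ C * ‖y - z‖ := fun s hs => by
    have := (hC s ⟨hs.1, hs.2.trans ht1⟩).dist_le_mul y (b1 hy) z (b1 hz)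
    rwa [dist_eq_norm, dist_eq_norm] at this
  have w2 : ∀ s ∈ Icc 0 t, ‖h (Y s y) - h (Y s z) - A (Y s y - Y s z)‖ ≤ ε' * (C * ‖y - z‖) :=
    fun s hs => (hη' _ (H s ⟨hs.1, hs.2.trans ht2⟩ y (b2 hy)) _
      (H s ⟨hs.1, hs.2.trans ht2⟩ z (b2 hz))).trans (by gcongr; exact w1 s hs)
  have w3 : ∀ s ∈ Icc 0 t, ‖h (Y s y) - h (Y s z)‖ ≤ (‖A‖ + ε') * C * ‖y - z‖ := fun s hs => by
    have e1 := norm_add_le (h (Y s y) - h (Y s z) - A (Y s y - Y s z)) (A (Y s y - Y s z))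
    rw [sub_add_cancel] at e1
    have e2 := A.le_opNorm (Y s y - Y s z)
    have e3 : ‖A‖ * ‖Y s y - Y s z‖ ≤ ‖A‖ * (C * ‖y - z‖) := by gcongr; exact w1 s hs
    have := w2 s hs
    nlinarith
  have hd : ∀ x, HasDerivAt (fun s => Y s y - Y s z) (h (Y x y) - h (Y x z)) x :=
    fun x => (hYd x y).sub (hYd x z)
  have w4 : ∀ s ∈ Icc 0 t, ‖Y s y - Y s z - (y - z)‖ ≤ (‖A‖ + ε') * C * ‖y - z‖ * s := by
    intro s hs
    have := norm_image_sub_le_of_norm_deriv_le_segment' (a := 0) (b := t)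
      (f := fun s => Y s y - Y s z) (f' := fun s => h (Y s y) - h (Y s z))
      (fun x _ => (hd x).hasDerivWithinAt) (fun x hx => w3 x ⟨hx.1, hx.2.le⟩) s hs
    simpa only [hY0, sub_zero] using this
  have w5 : ∀ s ∈ Icc 0 t, ‖h (Y s y) - h (Y s z) - A (y - z)‖ ≤ ε * ‖y - z‖ := fun s hs => by
    have e0 : h (Y s y) - h (Y s z) - A (y - z) = (h (Y s y) - h (Y s z) - A (Y s y - Y s z)) +
        A (Y s y - Y s z - (y - z)) := by
      rw [map_sub A (Y s y - Y s z)]; abel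
    rw [e0]
    have e1 := A.le_opNorm (Y s y - Y s z - (y - z))
    have e2 : ‖A‖ * ‖Y s y - Y s z - (y - z)‖ ≤ ‖A‖ * ((‖A‖ + ε') * C * ‖y - z‖ * s) := by
      gcongr; exact w4 s hs
    have e3 : ‖A‖ * ((‖A‖ + ε') * C * ‖y - z‖ * s) = L * s * ‖y - z‖ := by rw [hL]; ring
    have e4 : L * s ≤ ε / 2 := by
      have : s ≤ ε / (2 * (L + 1)) := hs.2.trans ht3
      rw [le_div_iff₀ (by positivity)] at this
      have := hs.1
      nlinarith
    have e5 : ε' * C ≤ ε / 2 := by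
      rw [hε', div_mul_eq_mul_div, div_le_iff₀ (by positivity)]
      nlinarith
    have e6 := w2 s hs
    have e7 := norm_nonneg (y - z)
    refine (norm_add_le _ _).trans ?_
    nlinarith
  have hd2 : ∀ x, HasDerivAt (fun s => Y s y - Y s z - s • A (y - z))
      (h (Y x y) - h (Y x z) - (1:ℝ) • A (y - z)) x :=
    fun x => (hd x).sub ((hasDerivAt_id x).smul_const _)
  have := norm_image_sub_le_of_norm_deriv_le_segment' (a := 0) (b := t) (C := ε * ‖y - z‖)
    (f := fun s => Y s y - Y s z - s • A (y - z))
    (f' := fun s => h (Y s y) - h (Y s z) - (1:ℝ) • A (y - z))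
    (fun x _ => (hd2 x).hasDerivWithinAt)
    (fun x hx => by rw [one_smul]; exact w5 x ⟨hx.1, hx.2.le⟩) t ⟨ht.1, le_rfl⟩
  simp only [hY0, zero_smul, sub_zero] at this
  convert this using 2
  abel

theorem aux_det {E : Type*} [NormedAddCommGroup E] [NormedSpace ℝ E] [FiniteDimensional ℝ E]
    {ε : ℝ} (hε : 0 < ε) :
    ∀ᶠ M : E →L[ℝ] E in 𝓝 0,
      |(1 + M).det - 1 - LinearMap.trace ℝ E (M : E →ₗ[ℝ] E)| ≤ ε * ‖M‖ := by
  let b := Module.finBasis ℝ E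
  let φ : (E →L[ℝ] E) →ₗ[ℝ] Matrix (Fin (Module.finrank ℝ E)) (Fin (Module.finrank ℝ E)) ℝ :=
    (LinearMap.toMatrix b b).toLinearMap ∘ₗ ContinuousLinearMap.coeLM ℝ
  have hφ1 : φ 1 = 1 := LinearMap.toMatrix_one b
  have hdet : ∀ M : E →L[ℝ] E, M.det = (φ M).det := fun M => (LinearMap.det_toMatrix b _).symm
  have htr : ∀ M : E →L[ℝ] E, LinearMap.trace ℝ E (M : E →ₗ[ℝ] E) = (φ M).trace :=
    fun M => LinearMap.trace_eq_matrix_trace ℝ b _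
  have hentry : ∀ i j, Differentiable ℝ (fun M : E →L[ℝ] E => φ M i j) := by
    intro i j
    let l : (E →L[ℝ] E) →ₗ[ℝ] ℝ := (Matrix.entryLinearMap ℝ ℝ i j) ∘ₗ φ
    exact (LinearMap.toContinuousLinearMap l).differentiable
  have hdiff : DifferentiableAt ℝ (fun M : E →L[ℝ] E => M.det) 1 := by
    have : (fun M : E →L[ℝ] E => M.det) = fun M => ∑ σ : Equiv.Perm (Fin (Module.finrank ℝ E)),
        (Equiv.Perm.sign σ : ℤ) * ∏ i, φ M (σ i) i := by
      ext M
      rw [hdet, Matrix.det_apply']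
    rw [this]
    apply Differentiable.differentiableAt
    refine Differentiable.fun_sum fun σ _ => ?_
    refine Differentiable.const_mul ?_ _
    exact fun M => (HasFDerivAt.finsetProd (fun i _ => (hentry (σ i) i M).hasFDerivAt)).differentiableAt
  have hfd := hdiff.hasFDerivAt
  have hval : ∀ M : E →L[ℝ] E, fderiv ℝ (fun M : E →L[ℝ] E => M.det) 1 M =
      LinearMap.trace ℝ E (M : E →ₗ[ℝ] E) := by
    intro M
    have h1 : HasDerivAt (fun r : ℝ => (1 : E →L[ℝ] E) + r • M) ((1:ℝ) • M) 0 :=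
      ((hasDerivAt_id (0:ℝ)).smul_const M).const_add 1
    have h2 : HasDerivAt (fun r : ℝ => ((1 : E →L[ℝ] E) + r • M).det)
        (fderiv ℝ (fun M : E →L[ℝ] E => M.det) 1 ((1:ℝ) • M)) 0 := by
      have hfd' : HasFDerivAt (fun M : E →L[ℝ] E => M.det)
          (fderiv ℝ (fun M : E →L[ℝ] E => M.det) 1) ((1 : E →L[ℝ] E) + (0:ℝ) • M) := by
        simpa using hfd
      exact hfd'.comp_hasDerivAt (0:ℝ) h1
    rw [one_smul] at h2
    set p := (Matrix.det (1 + (Polynomial.X : Polynomial ℝ) • (φ M).map Polynomial.C)).divX.divX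
      with hp
    have h3 : (fun r : ℝ => ((1 : E →L[ℝ] E) + r • M).det) =
        fun r => 1 + (φ M).trace * r + p.eval r * r ^ 2 := by
      ext r
      rw [hdet, map_add, map_smul, hφ1, Matrix.det_one_add_smul]
    rw [h3] at h2
    have h4 : HasDerivAt (fun r : ℝ => 1 + (φ M).trace * r + p.eval r * r ^ 2)
        ((φ M).trace * 1 + (p.derivative.eval 0 * 0 ^ 2 + p.eval 0 * (2 * 0 ^ (2 - 1) * 1))) 0 :=
      (((hasDerivAt_id (0:ℝ)).const_mul _).const_add 1).add
        ((p.hasDerivAt 0).mul ((hasDerivAt_id (0:ℝ)).pow 2))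
    have := h2.unique h4
    rw [this, htr]
    simp
  have := (hasFDerivAt_iff_isLittleO_nhds_zero.1 hfd).bound hε
  filter_upwards [this] with M hM
  rw [hval] at hM
  have h1 : (1 : E →L[ℝ] E).det = 1 := by rw [hdet, hφ1, Matrix.det_one]
  rw [h1, Real.norm_eq_abs] at hM
  exact hM

theorem aux_null {E : Type*} [NormedAddCommGroup E] [NormedSpace ℝ E] [FiniteDimensional ℝ E]
    [MeasurableSpace E] [BorelSpace E] (μ : MeasureTheory.Measure E) [μ.IsAddHaarMeasure]
    {f : E → E} (hf : ∀ y, ∃ δ > 0, ∃ C : NNReal, LipschitzOnWith C f (Metric.ball y δ))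
    {s : Set E} (hs : μ s = 0) : μ (f '' s) = 0 := by
  have ac1 : MeasureTheory.Measure.AbsolutelyContinuous μ
      (MeasureTheory.Measure.hausdorffMeasure (Module.finrank ℝ E : ℝ)) :=
    MeasureTheory.Measure.absolutelyContinuous_isAddHaarMeasure _ _
  have ac2 : MeasureTheory.Measure.AbsolutelyContinuous
      (MeasureTheory.Measure.hausdorffMeasure (Module.finrank ℝ E : ℝ)) μ :=
    MeasureTheory.Measure.absolutelyContinuous_isAddHaarMeasure _ _
  apply ac1
  have hs' := ac2 hs
  choose δ hδ C hC using hf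
  obtain ⟨t, htc, ht⟩ := TopologicalSpace.countable_cover_nhds
    (fun y => Metric.ball_mem_nhds y (hδ y))
  have hsub : f '' s ⊆ ⋃ y ∈ t, f '' (s ∩ Metric.ball y (δ y)) := by
    rintro _ ⟨x, hx, rfl⟩
    have : x ∈ ⋃ y ∈ t, Metric.ball y (δ y) := by rw [ht]; trivial
    simp only [mem_iUnion] at this ⊢
    obtain ⟨y, hy, hxy⟩ := this
    exact ⟨y, hy, x, ⟨hx, hxy⟩, rfl⟩
  refine MeasureTheory.measure_mono_null hsub ((MeasureTheory.measure_biUnion_null_iff htc).2 ?_)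
  intro y _
  have := ((hC y).mono (inter_subset_right (s := s))).hausdorffMeasure_image_le
    (d := (Module.finrank ℝ E : ℝ)) (by positivity)
  rw [MeasureTheory.measure_mono_null inter_subset_left hs', mul_zero] at this
  exact le_antisymm this bot_le

theorem aux_ae_diff {E : Type*} [NormedAddCommGroup E] [NormedSpace ℝ E] [FiniteDimensional ℝ E]
    [MeasurableSpace E] [BorelSpace E] (μ : MeasureTheory.Measure E) [μ.IsAddHaarMeasure]
    {f : E → E} (hf : ∀ y, ∃ δ > 0, ∃ C : NNReal, LipschitzOnWith C f (Metric.ball y δ)) :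
    ∀ᵐ y ∂μ, DifferentiableAt ℝ f y := by
  choose δ hδ C hC using hf
  obtain ⟨t, htc, ht⟩ := TopologicalSpace.countable_cover_nhds
    (fun y => Metric.ball_mem_nhds y (hδ y))
  have : ∀ᵐ x ∂μ, ∀ y ∈ t, x ∈ Metric.ball y (δ y) →
      DifferentiableWithinAt ℝ f (Metric.ball y (δ y)) x :=
    (MeasureTheory.ae_ball_iff htc).2 fun y _ => (hC y).ae_differentiableWithinAt_of_mem
  filter_upwards [this] with x hx
  have hxt : x ∈ ⋃ y ∈ t, Metric.ball y (δ y) := by rw [ht]; trivial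
  simp only [mem_iUnion] at hxt
  obtain ⟨y, hy, hxy⟩ := hxt
  exact (hx y hy hxy).differentiableAt (Metric.isOpen_ball.mem_nhds hxy)

theorem aux_detflow {E : Type*} [NormedAddCommGroup E] [NormedSpace ℝ E] [FiniteDimensional ℝ E]
    {h : E → E} (hh : ContDiff ℝ 1 h) {Y : ℝ → E → E} (hY0 : ∀ y, Y 0 y = y)
    (hYd : ∀ (t : ℝ) (y : E), HasDerivAt (fun s => Y s y) (h (Y t y)) t)
    (y0 : E) {ε : ℝ} (hε : 0 < ε) :
    ∃ δ > 0, ∀ t ∈ Icc 0 δ, ∀ y ∈ Metric.ball y0 δ, DifferentiableAt ℝ (Y t) y →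
      1 + t * (LinearMap.trace ℝ E (fderiv ℝ h y0 : E →ₗ[ℝ] E) - ε) ≤ (fderiv ℝ (Y t) y).det := by
  have : ProperSpace E := FiniteDimensional.proper ℝ E
  set A := fderiv ℝ h y0 with hA
  let tr : (E →L[ℝ] E) →L[ℝ] ℝ := LinearMap.toContinuousLinearMap
    (LinearMap.trace ℝ E ∘ₗ ContinuousLinearMap.coeLM ℝ)
  have htr : ∀ M : E →L[ℝ] E, LinearMap.trace ℝ E (M : E →ₗ[ℝ] E) = tr M := fun M => rfl
  set κ := min 1 (ε / (2 * (‖tr‖ + 1))) with hκ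
  have hκ0 : 0 < κ := by positivity
  have hκ1 : κ ≤ 1 := min_le_left _ _
  have hκ2 : ‖tr‖ * κ ≤ ε / 2 := by
    have : κ ≤ ε / (2 * (‖tr‖ + 1)) := min_le_right _ _
    rw [le_div_iff₀ (by positivity)] at this
    nlinarith
  set ν := ε / (2 * (‖A‖ + 1)) with hν
  have hν0 : 0 < ν := by positivity
  obtain ⟨m, hm, hdet⟩ := Metric.eventually_nhds_iff_ball.1 (aux_det (E := E) hν0)
  obtain ⟨δ, hδ, H⟩ := aux_expand hh hY0 hYd y0 hκ0
  refine ⟨min δ (m / (2 * (‖A‖ + 1))), by positivity, fun t ht y hy hdiff => ?_⟩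
  have ht0 := ht.1
  have ht1 : t ≤ δ := ht.2.trans (min_le_left _ _)
  have ht2 : t ≤ m / (2 * (‖A‖ + 1)) := ht.2.trans (min_le_right _ _)
  rw [le_div_iff₀ (by positivity)] at ht2
  have hy1 : y ∈ Metric.ball y0 δ := Metric.ball_subset_ball (min_le_left _ _) hy
  set F := fderiv ℝ (Y t) y with hF
  set N := F - 1 - t • A with hN
  have hNle : ‖N‖ ≤ κ * t := by
    have hd : HasFDerivAt (fun z => Y t z - z - t • A z) N y :=
      (hdiff.hasFDerivAt.sub (hasFDerivAt_id y)).sub (A.hasFDerivAt.const_smul t)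
    refine hd.le_of_lip' (by positivity) ?_
    filter_upwards [Metric.isOpen_ball.mem_nhds hy1] with z hz
    have := H t ⟨ht0, ht1⟩ z hz y hy1
    have e : Y t z - z - t • A z - (Y t y - y - t • A y) =
        Y t z - Y t y - (z - y) - t • A (z - y) := by
      rw [map_sub, smul_sub]; abel
    rw [e]
    calc _ ≤ _ := this
      _ = _ := by ring
  set M := F - 1 with hM
  have hMN : M = t • A + N := by rw [hN]; abel
  have hMle : ‖M‖ ≤ t * (‖A‖ + 1) := by
    rw [hMN]
    refine (norm_add_le _ _).trans ?_
    rw [norm_smul, Real.norm_of_nonneg ht0]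
    nlinarith
  have hMm : M ∈ Metric.ball (0 : E →L[ℝ] E) m := by
    rw [mem_ball_zero_iff]; linarith
  have hdM := hdet M hMm
  have hF1 : 1 + M = F := by rw [hM]; abel
  rw [hF1, htr, hMN, map_add, map_smul, ← hMN, smul_eq_mul] at hdM
  have h1 := (abs_le.1 hdM).1
  have h2 := (abs_le.1 ((Real.norm_eq_abs _) ▸ tr.le_opNorm N)).1
  rw [htr]
  have h3 : ν * ‖M‖ ≤ ε / 2 * t := by
    calc ν * ‖M‖ ≤ ν * (t * (‖A‖ + 1)) := by gcongr
      _ = ε / 2 * t := by rw [hν]; field_simp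
  have h4 : ‖tr‖ * ‖N‖ ≤ ε / 2 * t := by
    calc ‖tr‖ * ‖N‖ ≤ ‖tr‖ * (κ * t) := by gcongr
      _ = (‖tr‖ * κ) * t := by ring
      _ ≤ ε / 2 * t := by gcongr
  nlinarith

theorem aux_rho {E : Type*} [NormedAddCommGroup E] [NormedSpace ℝ E] [ProperSpace E]
    {h : E → E} (hh : ContDiff ℝ 1 h) {Y : ℝ → E → E} (hY0 : ∀ y, Y 0 y = y)
    (hYd : ∀ (t : ℝ) (y : E), HasDerivAt (fun s => Y s y) (h (Y t y)) t)
    (y0 : E) {ρ : E → ℝ} (hρ : ContDiffAt ℝ 1 ρ y0) {ε : ℝ} (hε : 0 < ε) :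
    ∃ δ > 0, ∀ t ∈ Icc 0 δ, ∀ y ∈ Metric.ball y0 δ,
      ρ y + t * (fderiv ℝ ρ y0 (h y0) - ε) ≤ ρ (Y t y) ∧ |ρ (Y t y) - ρ y0| < ε := by
  set D := fderiv ℝ ρ y0 with hD
  set κ := min 1 (ε / (‖h y0‖ + 1 + ‖D‖)) with hκ
  have hκ0 : 0 < κ := by positivity
  have hκ1 : κ ≤ 1 := min_le_left _ _
  have hκ2 : κ * (‖h y0‖ + 1 + ‖D‖) ≤ ε := by
    have : κ ≤ ε / (‖h y0‖ + 1 + ‖D‖) := min_le_right _ _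
    rwa [le_div_iff₀ (by positivity)] at this
  have hst : HasStrictFDerivAt ρ D y0 := hρ.hasStrictFDerivAt one_ne_zero
  obtain ⟨η, hη, hη'⟩ : ∃ η > 0, ∀ a ∈ Metric.ball y0 η, ∀ b ∈ Metric.ball y0 η,
      ‖ρ a - ρ b - D (a - b)‖ ≤ κ * ‖a - b‖ := by
    have := hst.isLittleO.bound hκ0
    rw [nhds_prod_eq, Metric.nhds_basis_ball.prod_self.eventually_iff] at this
    obtain ⟨η, hη, H⟩ := this
    exact ⟨η, hη, fun a ha b hb => H (show (a, b) ∈ _ from ⟨ha, hb⟩)⟩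
  obtain ⟨η2, hη2, hη2'⟩ := Metric.continuousAt_iff.1 hρ.continuousAt ε hε
  obtain ⟨δ1, hδ1, H1⟩ := aux_near hh hY0 hYd y0 (lt_min hη hη2)
  obtain ⟨δ2, hδ2, H2⟩ := aux_move hh hY0 hYd y0 hκ0
  refine ⟨min (min δ1 δ2) η, by positivity, fun t ht y hy => ?_⟩
  have t1 : t ≤ δ1 := ht.2.trans ((min_le_left _ _).trans (min_le_left _ _))
  have t2 : t ≤ δ2 := ht.2.trans ((min_le_left _ _).trans (min_le_right _ _))
  have y1 : y ∈ Metric.ball y0 δ1 :=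
    Metric.ball_subset_ball ((min_le_left _ _).trans (min_le_left _ _)) hy
  have y2 : y ∈ Metric.ball y0 δ2 :=
    Metric.ball_subset_ball ((min_le_left _ _).trans (min_le_right _ _)) hy
  have y3 : y ∈ Metric.ball y0 η := Metric.ball_subset_ball (min_le_right _ _) hy
  have hYm := H1 t ⟨ht.1, t1⟩ y y1
  have ht0 := ht.1
  constructor
  · have k1 := hη' _ (Metric.ball_subset_ball (min_le_left _ _) hYm) _ y3
    have k2 := H2 t ⟨ht.1, t2⟩ y y2
    have k3 : ‖Y t y - y‖ ≤ t * (‖h y0‖ + κ) := by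
      have := norm_add_le (Y t y - y - t • h y0) (t • h y0)
      rw [sub_add_cancel, norm_smul, Real.norm_of_nonneg ht0] at this
      nlinarith
    have k4 := D.le_opNorm (Y t y - y - t • h y0)
    rw [map_sub D (Y t y - y), map_smul, smul_eq_mul] at k4
    rw [Real.norm_eq_abs] at k1 k4
    have k5 := (abs_le.1 k1).1
    have k6 := (abs_le.1 k4).1
    have k7 : ‖D‖ * ‖Y t y - y - t • h y0‖ ≤ ‖D‖ * (κ * t) := by gcongr
    have k8 : κ * ‖Y t y - y‖ ≤ κ * (t * (‖h y0‖ + 1)) := by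
      gcongr
      exact k3.trans (by gcongr)
    have k9 : κ * (‖h y0‖ + 1 + ‖D‖) * t ≤ ε * t := by gcongr
    nlinarith
  · have := hη2' (Metric.ball_subset_ball (min_le_right _ _) hYm)
    rwa [Real.dist_eq] at this

theorem aux_diverg {E : Type*} [NormedAddCommGroup E] [NormedSpace ℝ E] [FiniteDimensional ℝ E]
    {h : E → E} {ρ : E → ℝ} {y : E} (hh : DifferentiableAt ℝ h y) (hρ : DifferentiableAt ℝ ρ y) :
    diverg (fun y => ρ y • h y) y =
      fderiv ℝ ρ y (h y) + ρ y * LinearMap.trace ℝ E (fderiv ℝ h y : E →ₗ[ℝ] E) := by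
  unfold diverg
  rw [(hρ.hasFDerivAt.fun_smul hh.hasFDerivAt).fderiv]
  have : ((ρ y • fderiv ℝ h y + (fderiv ℝ ρ y).smulRight (h y) : E →L[ℝ] E) : E →ₗ[ℝ] E) =
    ρ y • (fderiv ℝ h y : E →ₗ[ℝ] E) + (fderiv ℝ ρ y : E →ₗ[ℝ] ℝ).smulRight (h y) := rfl
  rw [this, map_add, map_smul, LinearMap.trace_smulRight, smul_eq_mul, add_comm]
  rfl

theorem aux_local {E : Type*} [NormedAddCommGroup E] [NormedSpace ℝ E] [FiniteDimensional ℝ E]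
    {h : E → E} (hh : ContDiff ℝ 1 h) {Y : ℝ → E → E} (hY0 : ∀ y, Y 0 y = y)
    (hYd : ∀ (t : ℝ) (y : E), HasDerivAt (fun s => Y s y) (h (Y t y)) t)
    (y0 : E) {ρ : E → ℝ} (hρ : ContDiffAt ℝ 1 ρ y0) (hρn : ∀ y, 0 ≤ ρ y)
    (hdiv : 0 < diverg (fun y => ρ y • h y) y0) :
    ∀ᶠ z : ℝ × E in 𝓝 ((0:ℝ), y0), 0 < z.1 → DifferentiableAt ℝ (Y z.1) z.2 →
      ρ z.2 < |(fderiv ℝ (Y z.1) z.2).det| * ρ (Y z.1 z.2) := by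
  have : ProperSpace E := FiniteDimensional.proper ℝ E
  rw [aux_diverg (hh.differentiable one_ne_zero y0) (hρ.differentiableAt one_ne_zero)] at hdiv
  set a := fderiv ℝ ρ y0 (h y0) with ha
  set q := LinearMap.trace ℝ E (fderiv ℝ h y0 : E →ₗ[ℝ] E) with hq
  obtain ⟨ε, hε, Hε⟩ : ∃ ε > 0, ∀ r, |r - ρ y0| < ε → 0 < (a - ε) + r * (q - ε) := by
    have hc : ContinuousAt (fun p : ℝ × ℝ => (a - p.1) + p.2 * (q - p.1)) (0, ρ y0) := by
      fun_prop
    have hp : ∀ᶠ p : ℝ × ℝ in 𝓝 (0, ρ y0), 0 < (a - p.1) + p.2 * (q - p.1) := by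
      refine hc.eventually (lt_mem_nhds ?_)
      simpa using hdiv
    obtain ⟨e, he, He⟩ := Metric.eventually_nhds_iff_ball.1 hp
    refine ⟨e / 2, by positivity, fun r hr => He (e / 2, r) ?_⟩
    rw [Metric.mem_ball, Prod.dist_eq, max_lt_iff]
    constructor
    · rw [Real.dist_eq]; simp only [sub_zero]; rw [abs_of_pos (by positivity)]; linarith
    · rw [Real.dist_eq]; simp only; linarith
  obtain ⟨δ1, hδ1, H1⟩ := aux_rho hh hY0 hYd y0 hρ hε
  obtain ⟨δ2, hδ2, H2⟩ := aux_detflow hh hY0 hYd y0 hε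
  rw [Metric.eventually_nhds_iff_ball]
  refine ⟨min δ1 δ2, by positivity, ?_⟩
  rintro ⟨t, y⟩ hz ht hdiff
  simp only at ht hdiff ⊢
  rw [Metric.mem_ball, Prod.dist_eq, max_lt_iff] at hz
  obtain ⟨hz1, hz2⟩ := hz
  simp only [Real.dist_eq, sub_zero] at hz1 hz2
  rw [abs_of_pos ht, lt_min_iff] at hz1
  rw [lt_min_iff] at hz2
  have k1 := H1 t ⟨ht.le, hz1.1.le⟩ y hz2.1
  have k2 := H2 t ⟨ht.le, hz1.2.le⟩ y hz2.2 hdiff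
  rw [← hq] at k2
  have k3 := Hε _ k1.2
  have k4 := hρn (Y t y)
  have k5 : (1 + t * (q - ε)) * ρ (Y t y) ≤ |(fderiv ℝ (Y t) y).det| * ρ (Y t y) :=
    mul_le_mul_of_nonneg_right (k2.trans (le_abs_self _)) k4
  have k6 := mul_pos ht k3
  have k7 := k1.1
  nlinarith

theorem aux_Znull {E : Type*} [NormedAddCommGroup E] [NormedSpace ℝ E] [FiniteDimensional ℝ E]
    [MeasurableSpace E] [BorelSpace E] (μ : MeasureTheory.Measure E) [μ.IsAddHaarMeasure]
    {h : E → E} (hh : ContDiff ℝ 1 h) {Y : ℝ → E → E} (hY0 : ∀ y, Y 0 y = y)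
    (hYd : ∀ (t : ℝ) (y : E), HasDerivAt (fun s => Y s y) (h (Y t y)) t)
    (hYflow : ∀ (t s : ℝ) (y : E), Y (t + s) y = Y t (Y s y))
    {ρ : E → ℝ} (hρn : ∀ y, 0 ≤ ρ y) {R Z : Set E} (hR : IsCompact R)
    (hρ : ∀ y ∈ R, ContDiffAt ℝ 1 ρ y)
    (hdiv : ∀ y ∈ R, 0 < diverg (fun y => ρ y • h y) y)
    (hZm : MeasurableSet Z) (hZR : Z ⊆ R) (hZ : ∀ t, 0 ≤ t → ∀ y ∈ Z, Y t y ∈ Z) :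
    μ Z = 0 := by
  have : ProperSpace E := FiniteDimensional.proper ℝ E
  have ev := hR.eventually_forall_of_forall_eventually (x₀ := (0:ℝ))
    (P := fun t y => 0 < t → DifferentiableAt ℝ (Y t) y →
      ρ y < |(fderiv ℝ (Y t) y).det| * ρ (Y t y))
    (fun y hy => aux_local hh hY0 hYd y (hρ y hy) hρn (hdiv y hy))
  obtain ⟨t, hev, ht⟩ := ((ev.filter_mono (nhdsWithin_le_nhds (s := Ioi 0))).and
    self_mem_nhdsWithin).exists
  have ht : 0 < t := ht
  have hlip : ∀ y, ∃ δ > 0, ∃ C : NNReal, LipschitzOnWith C (Y t) (Metric.ball y δ) := by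
    intro y
    obtain ⟨δ, hδ, C, hC⟩ := aux_flowlip hh hY0 hYd t y
    exact ⟨δ, hδ, C, hC t ⟨ht.le, le_rfl⟩⟩
  have hYc : Continuous (Y t) := continuous_iff_continuousAt.2 fun y => by
    obtain ⟨δ, hδ, C, hC⟩ := hlip y
    exact hC.continuousOn.continuousAt (Metric.ball_mem_nhds y hδ)
  have hinj : Function.Injective (Y t) := fun a b hab => by
    have h1 := hYflow (-t) t a
    have h2 := hYflow (-t) t b
    rw [neg_add_cancel, hY0] at h1 h2
    rw [h1, h2, hab]
  set s := Z ∩ {y | DifferentiableAt ℝ (Y t) y} with hs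
  have hsm : MeasurableSet s := hZm.inter (measurableSet_of_differentiableAt ℝ (Y t))
  have hsZ : s =ᵐ[μ] Z := by
    filter_upwards [aux_ae_diff μ hlip] with y hy
    apply propext
    exact ⟨fun hx => hx.1, fun hx => ⟨hx, hy⟩⟩
  have hsR : s ⊆ R := inter_subset_left.trans hZR
  have hρc : ContinuousOn ρ R := fun y hy => (hρ y hy).continuousAt.continuousWithinAt
  have hint := MeasureTheory.lintegral_image_eq_lintegral_abs_det_fderiv_mul μ hsm
    (fun x hx => (hx.2.hasFDerivAt).hasFDerivWithinAt) hinj.injOn (fun y => ENNReal.ofReal (ρ y))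
  have hle : ∫⁻ x in (Y t) '' s, ENNReal.ofReal (ρ x) ∂μ ≤ ∫⁻ x in s, ENNReal.ofReal (ρ x) ∂μ := by
    rw [MeasureTheory.setLIntegral_congr hsZ]
    refine MeasureTheory.lintegral_mono_set ?_
    rintro _ ⟨y, hy, rfl⟩
    exact hZ t ht.le y hy.1
  rw [hint] at hle
  have hfin : ∫⁻ x in s, ENNReal.ofReal (ρ x) ∂μ ≠ ⊤ := by
    obtain ⟨C, hC⟩ := hR.exists_bound_of_continuousOn hρc
    have : ∫⁻ x in s, ENNReal.ofReal (ρ x) ∂μ ≤ ENNReal.ofReal C * μ s := by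
      rw [← MeasureTheory.setLIntegral_const]
      refine MeasureTheory.setLIntegral_mono measurable_const fun x hx => ?_
      exact ENNReal.ofReal_le_ofReal ((le_abs_self _).trans (hC x (hsR hx)))
    refine ne_top_of_le_ne_top ?_ this
    exact ENNReal.mul_ne_top ENNReal.ofReal_ne_top
      (ne_top_of_le_ne_top hR.measure_lt_top.ne (MeasureTheory.measure_mono hsR))
  have hlt : ∀ x ∈ s, ENNReal.ofReal (ρ x) <
      ENNReal.ofReal |(fderiv ℝ (Y t) x).det| * ENNReal.ofReal (ρ (Y t x)) := by
    intro x hx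
    rw [← ENNReal.ofReal_mul (abs_nonneg _)]
    exact (ENNReal.ofReal_lt_ofReal_iff_of_nonneg (hρn x)).2 (hev x (hsR hx) ht hx.2)
  have haem : AEMeasurable (fun x => ENNReal.ofReal |(fderiv ℝ (Y t) x).det| *
      ENNReal.ofReal (ρ (Y t x))) (μ.restrict s) := by
    have m1 : AEMeasurable (fun x => ENNReal.ofReal |(fderiv ℝ (Y t) x).det|) (μ.restrict s) := by
      refine Measurable.aemeasurable ?_
      refine ENNReal.measurable_ofReal.comp ?_
      exact (continuous_abs.comp ContinuousLinearMap.continuous_det).measurable.comp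
        (measurable_fderiv ℝ (Y t))
    have m2 : AEMeasurable (fun x => ENNReal.ofReal (ρ (Y t x))) (μ.restrict s) := by
      refine ENNReal.measurable_ofReal.comp_aemeasurable ?_
      refine ContinuousOn.aemeasurable ?_ hsm
      exact hρc.comp hYc.continuousOn fun x hx => hZR (hZ t ht.le x hx.1)
    exact m1.mul m2
  have hae := MeasureTheory.ae_eq_of_ae_le_of_lintegral_le
    ((MeasureTheory.ae_restrict_iff' hsm).2 (Filter.Eventually.of_forall fun x hx => (hlt x hx).le))
    hfin haem hle
  have hs0 : μ s = 0 := by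
    have h1 := (MeasureTheory.ae_restrict_iff' hsm).1 hae
    rw [MeasureTheory.ae_iff] at h1
    refine MeasureTheory.measure_mono_null (fun x hx => ?_) h1
    simp only [mem_ofPred_eq, Classical.not_imp]
    exact ⟨hx, (hlt x hx).ne⟩
  rw [← MeasureTheory.measure_congr hsZ]
  exact hs0

/-- **Theorem 1** (almost global asymptotic stability). -/
theorem theorem1_almost_global_asymptotic_stability
    (k : ℕ) (hk : 1 ≤ k)
    (h : EuclideanSpace ℝ (Fin k) → EuclideanSpace ℝ (Fin k)) (hh : ContDiff ℝ 1 h)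
    -- global flow of ẏ = h(y)
    (Y : ℝ → EuclideanSpace ℝ (Fin k) → EuclideanSpace ℝ (Fin k))
    (hY0 : ∀ y, Y 0 y = y)
    (hYd : ∀ (t : ℝ) (y : EuclideanSpace ℝ (Fin k)),
      HasDerivAt (fun s => Y s y) (h (Y t y)) t)
    (hYflow : ∀ (t s : ℝ) (y : EuclideanSpace ℝ (Fin k)), Y (t + s) y = Y t (Y s y))
    -- Lyapunov-like data
    (Ul Ug : EuclideanSpace ℝ (Fin k) → ℝ)
    (hUlc : Continuous Ul) (hUlp : ProperFun Ul) (hUlpd : PosDefFun Ul)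
    (hUlnn : ∀ y, 0 ≤ Ul y)
    (hUlLip : LocallyLipschitzOnSet Ul
      (({(0 : EuclideanSpace ℝ (Fin k))} : Set (EuclideanSpace ℝ (Fin k)))ᶜ))
    (hUgc : Continuous Ug) (hUgp : ProperFun Ug) (hUgpd : PosDefFun Ug)
    (hUgnn : ∀ y, 0 ≤ Ug y)
    (hUgLip : LocallyLipschitzOnSet Ug
      (({(0 : EuclideanSpace ℝ (Fin k))} : Set (EuclideanSpace ℝ (Fin k)))ᶜ))
    (El Eg : EuclideanSpace ℝ (Fin k) → ℝ)
    (hElc : Continuous El) (hElpd : PosDefFun El) (hElnn : ∀ y, 0 ≤ El y)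
    (hEgc : Continuous Eg) (hEgpd : PosDefFun Eg) (hEgnn : ∀ y, 0 ≤ Eg y)
    (Mhl Mtg : ℝ) (hMhl : 0 < Mhl) (hMtg : 0 < Mtg)
    -- (i)
    (hi : ∀ y : EuclideanSpace ℝ (Fin k), y ≠ 0 → Ul y ≤ Mhl →
      dini Ul (h y) y ≤ ((-(El y) : ℝ) : EReal))
    -- (ii)
    (hii : ∀ y : EuclideanSpace ℝ (Fin k), Mtg ≤ Ug y →
      dini Ug (h y) y ≤ ((-(Eg y) : ℝ) : EReal))
    -- (iii)
    (hiii : {y : EuclideanSpace ℝ (Fin k) | Ul y ≤ Mhl} ⊂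
            {y : EuclideanSpace ℝ (Fin k) | Ug y ≤ Mtg})
    -- the density ρ
    (ρ : EuclideanSpace ℝ (Fin k) → ℝ) (hρnn : ∀ y, 0 ≤ ρ y)
    (hρC1 : ContDiffOn ℝ 1 ρ
      (({(0 : EuclideanSpace ℝ (Fin k))} : Set (EuclideanSpace ℝ (Fin k)))ᶜ))
    (hρsupp : closure ({y : EuclideanSpace ℝ (Fin k) | Ug y ≤ Mtg} \
        {y : EuclideanSpace ℝ (Fin k) | Ul y ≤ Mhl}) ⊆ {y | ρ y ≠ 0})
    (hdiv : ∀ y ∈ closure ({y : EuclideanSpace ℝ (Fin k) | Ug y ≤ Mtg} \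
        {y : EuclideanSpace ℝ (Fin k) | Ul y ≤ Mhl}),
      0 < diverg (fun y => ρ y • h y) y) :
    -- Lyapunov stability of the origin
    (∀ ε : ℝ, 0 < ε → ∃ δ : ℝ, 0 < δ ∧
      ∀ y : EuclideanSpace ℝ (Fin k), ‖y‖ < δ → ∀ t : ℝ, 0 ≤ t → ‖Y t y‖ < ε) ∧
    -- attractivity for almost every initial condition
    ∃ N : Set (EuclideanSpace ℝ (Fin k)), MeasureTheory.volume N = 0 ∧
      ∀ y : EuclideanSpace ℝ (Fin k), y ∉ N →
        Filter.Tendsto (fun t : ℝ => Y t y) Filter.atTop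
          (𝓝 (0 : EuclideanSpace ℝ (Fin k))) := by
  have hUl0 := hUlpd.1
  -- forward invariance and entrance for `Ul`
  have reachL : ∀ c, 0 < c → c ≤ Mhl → ∀ hi', c ≤ hi' → hi' ≤ Mhl →
      ∃ m > 0, ∀ y, Ul y ≤ hi' → ∀ t, 0 ≤ t → Ul (Y t y) ≤ max c (hi' - m * t) := by
    intro c hc _ hi' h1 h2
    refine aux_reach hY0 hYd hUlc hUlp hUl0 hUlLip hElc hElpd hc h1 fun y hy1 hy2 => ?_
    refine hi y ?_ (hy2.trans h2)
    rintro rfl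
    linarith
  have invL : ∀ c, 0 < c → c ≤ Mhl → ∀ y, Ul y ≤ c → ∀ t, 0 ≤ t → Ul (Y t y) ≤ c := by
    intro c hc1 hc2 y hy t ht
    obtain ⟨m, hm, H⟩ := reachL c hc1 hc2 c le_rfl hc2
    refine (H y hy t ht).trans (max_le le_rfl ?_)
    nlinarith
  have reachG : ∀ hi', Mtg ≤ hi' →
      ∃ m > 0, ∀ y, Ug y ≤ hi' → ∀ t, 0 ≤ t → Ug (Y t y) ≤ max Mtg (hi' - m * t) := by
    intro hi' h1
    exact aux_reach hY0 hYd hUgc hUgp hUgpd.1 hUgLip hEgc hEgpd hMtg h1 fun y hy1 _ => hii y hy1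
  have invG : ∀ y, Ug y ≤ Mtg → ∀ t, 0 ≤ t → Ug (Y t y) ≤ Mtg := by
    intro y hy t ht
    obtain ⟨m, hm, H⟩ := reachG Mtg le_rfl
    refine (H y hy t ht).trans (max_le le_rfl ?_)
    nlinarith
  have enterG : ∀ y, ∃ n : ℕ, Ug (Y n y) ≤ Mtg := by
    intro y
    obtain ⟨m, hm, H⟩ := reachG (max Mtg (Ug y)) (le_max_left _ _)
    obtain ⟨n, hn⟩ := exists_nat_ge ((max Mtg (Ug y) - Mtg) / m)
    refine ⟨n, (H y (le_max_right _ _) n (Nat.cast_nonneg n)).trans (max_le le_rfl ?_)⟩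
    rw [div_le_iff₀ hm] at hn
    linarith
  -- attraction inside the local set
  have attr : ∀ y, Ul y ≤ Mhl → Tendsto (fun t : ℝ => Y t y) atTop (𝓝 0) := by
    intro y hy
    rw [Metric.tendsto_atTop]
    intro ε hε
    obtain ⟨c, hc0, hcM, hc⟩ := aux_small hUlc hUlp hUlpd hMhl hε
    obtain ⟨m, hm, H⟩ := reachL c hc0 hcM Mhl hcM le_rfl
    refine ⟨max 0 ((Mhl - c) / m), fun t ht => ?_⟩
    have t0 : 0 ≤ t := (le_max_left _ _).trans ht
    have t1 : (Mhl - c) / m ≤ t := (le_max_right _ _).trans ht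
    rw [div_le_iff₀ hm] at t1
    rw [dist_zero_right]
    exact hc _ ((H y hy t t0).trans (max_le le_rfl (by linarith)))
  have attr' : ∀ (y : EuclideanSpace ℝ (Fin k)) (n : ℕ), Ul (Y n y) ≤ Mhl →
      Tendsto (fun t : ℝ => Y t y) atTop (𝓝 0) := by
    intro y n hn
    have h1 := (attr _ hn).comp (tendsto_atTop_add_const_right atTop (-(n:ℝ)) tendsto_id)
    refine h1.congr fun t => ?_
    simp only [Function.comp, id]
    rw [← hYflow, neg_add_cancel_right]
  have hYcont : ∀ t, 0 ≤ t → Continuous (Y t) := fun t ht =>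
    continuous_iff_continuousAt.2 fun y => by
      obtain ⟨δ, hδ, C, hC⟩ := aux_flowlip hh hY0 hYd t y
      exact (hC t ⟨ht, le_rfl⟩).continuousOn.continuousAt (Metric.ball_mem_nhds y hδ)
  constructor
  · intro ε hε
    obtain ⟨c, hc0, hcM, hc⟩ := aux_small hUlc hUlp hUlpd hMhl hε
    have hev : ∀ᶠ y in 𝓝 (0 : EuclideanSpace ℝ (Fin k)), Ul y < c :=
      hUlc.continuousAt.eventually (gt_mem_nhds (by rw [hUl0]; exact hc0))
    obtain ⟨δ, hδ, H⟩ := Metric.eventually_nhds_iff_ball.1 hev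
    refine ⟨δ, hδ, fun y hy t ht => hc _ (invL c hc0 hcM y (H y ?_).le t ht)⟩
    rwa [mem_ball_zero_iff]
  · set R := closure ({y : EuclideanSpace ℝ (Fin k) | Ug y ≤ Mtg} \
        {y : EuclideanSpace ℝ (Fin k) | Ul y ≤ Mhl}) with hRdef
    set Z : Set (EuclideanSpace ℝ (Fin k)) :=
      {y | Ug y ≤ Mtg} ∩ ⋂ n : ℕ, {y | Mhl < Ul (Y n y)} with hZdef
    have hRG : R ⊆ {y | Ug y ≤ Mtg} :=
      closure_minimal diff_subset (isClosed_le hUgc continuous_const)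
    have hR : IsCompact R :=
      (aux_proper_compact hUgc hUgp Mtg).of_isClosed_subset isClosed_closure hRG
    have hR0 : ∀ y ∈ R, y ≠ 0 := by
      have hsub : R ⊆ {y | Mhl ≤ Ul y} := by
        refine closure_minimal ?_ (isClosed_le continuous_const hUlc)
        intro y hy
        have hy2 : ¬ Ul y ≤ Mhl := hy.2
        show Mhl ≤ Ul y
        exact (not_le.1 hy2).le
      rintro y hy rfl
      have : Mhl ≤ Ul 0 := hsub hy
      linarith
    have hρR : ∀ y ∈ R, ContDiffAt ℝ 1 ρ y := fun y hy =>
      hρC1.contDiffAt (isOpen_compl_singleton.mem_nhds (hR0 y hy))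
    have hZm : MeasurableSet Z := by
      refine (isClosed_le hUgc continuous_const).measurableSet.inter
        (MeasurableSet.iInter fun n => ?_)
      exact (isOpen_lt continuous_const
        (hUlc.comp (hYcont n (Nat.cast_nonneg n)))).measurableSet
    have hZmem : ∀ y, y ∈ Z ↔ Ug y ≤ Mtg ∧ ∀ n : ℕ, Mhl < Ul (Y n y) := by
      intro y
      rw [hZdef, mem_inter_iff, mem_iInter]
      rfl
    have hZR : Z ⊆ R := by
      intro y hy
      have hy' := (hZmem y).1 hy
      refine subset_closure ⟨hy'.1, ?_⟩
      have := hy'.2 0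
      rw [Nat.cast_zero, hY0] at this
      exact not_le.2 this
    have hZinv : ∀ t, 0 ≤ t → ∀ y ∈ Z, Y t y ∈ Z := by
      intro t ht y hy
      have hy' := (hZmem y).1 hy
      refine (hZmem _).2 ⟨invG y hy'.1 t ht, fun n => ?_⟩
      by_contra hcon
      rw [not_lt] at hcon
      obtain ⟨N, hN⟩ := exists_nat_ge ((n:ℝ) + t)
      have h1 := invL Mhl hMhl le_rfl _ hcon (N - (n + t)) (by linarith)
      rw [← hYflow, ← hYflow] at h1
      have h2 : (N:ℝ) - (n + t) + (n + t) = N := by ring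
      rw [add_assoc] at h1
      rw [h2] at h1
      exact absurd (hy'.2 N) (not_lt.2 h1)
    have hZ0 : MeasureTheory.volume Z = 0 :=
      aux_Znull MeasureTheory.volume hh hY0 hYd hYflow hρnn hR hρR hdiv hZm hZR hZinv
    refine ⟨⋃ n : ℕ, Y (-(n:ℝ)) '' Z, ?_, ?_⟩
    · refine MeasureTheory.measure_iUnion_null fun n => ?_
      refine aux_null MeasureTheory.volume (fun y => ?_) hZ0
      have hdneg : ∀ (t : ℝ) (y : EuclideanSpace ℝ (Fin k)),
          HasDerivAt (fun s => Y (-s) y) ((fun x => -h x) (Y (-t) y)) t := by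
        intro t y
        have := (hYd (-t) y).scomp t (hasDerivAt_neg t)
        simpa [Function.comp_def] using this
      obtain ⟨δ, hδ, C, hC⟩ := aux_flowlip (Y := fun s y => Y (-s) y) hh.neg
        (fun y => by rw [neg_zero, hY0]) hdneg n y
      exact ⟨δ, hδ, C, hC n ⟨Nat.cast_nonneg n, le_rfl⟩⟩
    · intro y hy
      by_contra hcon
      have hout : ∀ n : ℕ, Mhl < Ul (Y n y) := by
        intro n
        by_contra hn
        exact hcon (attr' y n (not_lt.1 hn))
      obtain ⟨n, hn⟩ := enterG y
      refine hy (mem_iUnion.2 ⟨n, Y n y, (hZmem _).2 ⟨hn, fun j => ?_⟩, ?_⟩)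
      · rw [← hYflow, ← Nat.cast_add]
        exact hout _
      · rw [← hYflow, neg_add_cancel, hY0]
end
end

section
/- Theorem 2 (global asymptotic stability in the plane). Let h : ℝ² → ℝ² be C¹, and suppose every solution of ẏ = h(y) exists for all forward time, giving a forward flow Y : [0,∞) × ℝ² → ℝ² with Y(0,y) = y and ∂_t Y(t,y) = h(Y(t,y)). Suppose there exist continuous, proper, positive definite functions U_ℓ, U_g : ℝ² → [0,∞) that are locally Lipschitz on ℝ² \ {0}, continuous positive definite functions E_ℓ, E_g : ℝ² → [0,∞), and constants M̂_ℓ > 0 and M̃_g > 0 such that: (i) D⁺_h U_ℓ(y) ≤ −E_ℓ(y) for every y ≠ 0 with U_ℓ(y) ≤ M̂_ℓ; (ii) D⁺_h U_g(y) ≤ −E_g(y) for every y with U_g(y) ≥ M̃_g; (iii) Ω_{≤M̂_ℓ}(U_ℓ) is strictly contained in Ω_{≤M̃_g}(U_g). Let R := cl(Ω_{≤M̃_g}(U_g) \ Ω_{≤M̂_ℓ}(U_ℓ)). If for every y ∈ R one has div h(y) ≠ 0 and h(y) ≠ 0, then the origin is globally asymptotically stable for ẏ = h(y): it is Lyapunov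 stable (for every ε > 0 there exists δ > 0 such that |y| < δ implies |Y(t,y)| < ε for all t ≥ 0), and Y(t,y) → 0 as t → ∞ for every y ∈ ℝ². -/
open Filter Topology Set

noncomputable section

/-- A complete flow of the vector field `f`. -/
structure IsFlow {E : Type*} [NormedAddCommGroup E] [NormedSpace ℝ E]
    (f : E → E) (ψ : ℝ → E → E) : Prop where
  zero : ∀ y, ψ 0 y = y
  add : ∀ s t y, ψ (s + t) y = ψ s (ψ t y)
  deriv : ∀ t y, HasDerivAt (fun s => ψ s y) (f (ψ t y)) t
  cont : ∀ t, Continuous (ψ t)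

lemma IsFlow.neg {E : Type*} [NormedAddCommGroup E] [NormedSpace ℝ E]
    {f : E → E} {ψ : ℝ → E → E} (H : IsFlow f ψ) : IsFlow (fun x => - f x) (fun t => ψ (-t)) where
  zero y := by simpa using H.zero y
  add s t y := by rw [neg_add, H.add]
  deriv t y := by
    have := (H.deriv (-t) y).scomp t (hasDerivAt_neg t)
    simpa [Function.comp_def] using this
  cont t := H.cont (-t)

lemma IsFlow.cont_time {E : Type*} [NormedAddCommGroup E] [NormedSpace ℝ E]
    {f : E → E} {ψ : ℝ → E → E} (H : IsFlow f ψ) (y : E) : Continuous (fun t => ψ t y) :=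
  continuous_iff_continuousAt.2 fun t => (H.deriv t y).continuousAt

lemma exists_flow {E : Type*} [NormedAddCommGroup E] [NormedSpace ℝ E] [CompleteSpace E]
    (g : E → E) (K L : NNReal) (hg : LipschitzWith K g) (hL : ∀ x, ‖g x‖ ≤ L) :
    ∃ Φ : ℝ → E → E, IsFlow g Φ := by
  have hsol : ∀ (n : ℕ) (y : E), ∃ α : ℝ → E, α 0 = y ∧
      ∀ t ∈ Ioo (-(n:ℝ)) n, HasDerivAt α (g (α t)) t := by
    intro n y
    have h0 : (0:ℝ) ∈ Icc (-(n:ℝ)) n := by constructor <;> simp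
    have hP : IsPicardLindelof (fun _ => g) (⟨0, h0⟩ : Icc (-(n:ℝ)) n) y (L * n) 0 L K := by
      refine ⟨fun _ _ => hg.lipschitzOnWith, fun _ _ => continuousOn_const,
        fun _ _ x _ => hL x, ?_⟩
      simp
    obtain ⟨α, h1, h2⟩ := hP.exists_eq_forall_mem_Icc_hasDerivWithinAt₀
    refine ⟨α, h1, fun t ht => (h2 t (Ioo_subset_Icc_self ht)).hasDerivAt (Icc_mem_nhds ht.1 ht.2)⟩
  choose α hα0 hα using hsol
  have huniq : ∀ (m : ℕ) (β γ : ℝ → E) (t0 : ℝ), t0 ∈ Ioo (-(m:ℝ)) m →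
      (∀ t ∈ Ioo (-(m:ℝ)) m, HasDerivAt β (g (β t)) t) →
      (∀ t ∈ Ioo (-(m:ℝ)) m, HasDerivAt γ (g (γ t)) t) → β t0 = γ t0 →
      EqOn β γ (Ioo (-(m:ℝ)) m) := by
    intro m β γ t0 ht0 h1 h2 h3
    exact ODE_solution_unique_of_mem_Ioo (v := fun _ => g) (s := fun _ => univ) (K := K)
      (fun _ _ => hg.lipschitzOnWith) ht0 (fun t ht => ⟨h1 t ht, trivial⟩)
      (fun t ht => ⟨h2 t ht, trivial⟩) h3
  let N : ℝ → ℕ := fun t => ⌈|t|⌉₊ + 1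
  have hN : ∀ t, t ∈ Ioo (-(N t : ℝ)) (N t) := by
    intro t
    have : |t| < (N t : ℝ) := by
      have := Nat.le_ceil |t|
      simp only [N]; push_cast; linarith
    exact abs_lt.1 this
  let Φ : ℝ → E → E := fun t y => α (N t) y t
  have hpos : ∀ m : ℕ, ∀ t : ℝ, t ∈ Ioo (-(m:ℝ)) m → (0:ℝ) ∈ Ioo (-(m:ℝ)) m := by
    intro m t ht
    have : (0:ℝ) < m := by linarith [ht.1, ht.2]
    exact ⟨by linarith, this⟩
  have hcoh : ∀ (m : ℕ) (y : E) (t : ℝ), t ∈ Ioo (-(m:ℝ)) m → Φ t y = α m y t := by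
    intro m y t ht
    rcases le_total m (N t) with h | h
    · have hsub : Ioo (-(m:ℝ)) m ⊆ Ioo (-(N t:ℝ)) (N t) := by
        have : (m:ℝ) ≤ N t := by exact_mod_cast h
        exact Ioo_subset_Ioo (by linarith) this
      exact huniq m (α (N t) y) (α m y) 0 (hpos m t ht)
        (fun s hs => hα (N t) y s (hsub hs)) (hα m y) (by rw [hα0, hα0]) ht
    · have hsub : Ioo (-(N t:ℝ)) (N t) ⊆ Ioo (-(m:ℝ)) m := by
        have : (N t:ℝ) ≤ m := by exact_mod_cast h
        exact Ioo_subset_Ioo (by linarith) this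
      exact huniq (N t) (α (N t) y) (α m y) 0 (hpos _ t (hN t))
        (hα (N t) y) (fun s hs => hα m y s (hsub hs)) (by rw [hα0, hα0]) (hN t)
  have hΦ0 : ∀ y, Φ 0 y = y := fun y => hα0 _ y
  have hΦd : ∀ t y, HasDerivAt (fun s => Φ s y) (g (Φ t y)) t := by
    intro t y
    have h1 : (fun s => Φ s y) =ᶠ[𝓝 t] α (N t) y := by
      filter_upwards [Ioo_mem_nhds (hN t).1 (hN t).2] with s hs using hcoh (N t) y s hs
    exact (hα (N t) y t (hN t)).congr_of_eventuallyEq h1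
  have huu : ∀ (β γ : ℝ → E), (∀ t, HasDerivAt β (g (β t)) t) → (∀ t, HasDerivAt γ (g (γ t)) t) →
      β 0 = γ 0 → β = γ := by
    intro β γ h1 h2 h3
    exact ODE_solution_unique_univ (v := fun _ => g) (s := fun _ => univ) (K := K) (t₀ := 0)
      (fun _ => hg.lipschitzOnWith) (fun t => ⟨h1 t, trivial⟩) (fun t => ⟨h2 t, trivial⟩) h3
  have hadd : ∀ s t y, Φ (s + t) y = Φ s (Φ t y) := by
    intro s t y
    have := huu (fun s => Φ (s + t) y) (fun s => Φ s (Φ t y))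
      (fun s => by simpa using (hΦd (s + t) y).comp_add_const s t) (fun s => hΦd s _)
      (by simp [hΦ0])
    exact congrFun this s
  have hcontpos : ∀ (g' : E → E) (Ψ : ℝ → E → E), LipschitzWith K g' → (∀ y, Ψ 0 y = y) →
      (∀ t y, HasDerivAt (fun s => Ψ s y) (g' (Ψ t y)) t) → ∀ t, 0 ≤ t → Continuous (Ψ t) := by
    intro g' Ψ hg' h0 hd t ht
    have : LipschitzWith (Real.toNNReal (Real.exp (K * t))) (Ψ t) := by
      refine LipschitzWith.of_dist_le_mul fun x y => ?_
      have := dist_le_of_trajectories_ODE (v := fun _ => g') (K := K) (a := 0) (b := t)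
        (f := fun s => Ψ s x) (g := fun s => Ψ s y) (δ := dist x y)
        (fun _ => hg') (fun s _ => (hd s x).continuousAt.continuousWithinAt)
        (fun s _ => (hd s x).hasDerivWithinAt) (fun s _ => (hd s y).continuousAt.continuousWithinAt)
        (fun s _ => (hd s y).hasDerivWithinAt) (by simp [h0]) t ⟨ht, le_rfl⟩
      rw [Real.coe_toNNReal _ (Real.exp_pos _).le, mul_comm]
      simpa using this
    exact this.continuous
  refine ⟨Φ, hΦ0, hadd, hΦd, fun t => ?_⟩
  rcases le_total 0 t with ht | ht
  · exact hcontpos g Φ hg hΦ0 hΦd t ht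
  · have := hcontpos (fun x => - g x) (fun t => Φ (-t)) hg.neg (by simpa using hΦ0)
      (fun t y => by
        have := (hΦd (-t) y).scomp t (hasDerivAt_neg t)
        simpa [Function.comp_def] using this) (-t) (by linarith)
    simpa using this

/-- Continuous induction on a half line. -/
lemma barrier (u : ℝ → ℝ) (hu : Continuous u) (T : ℝ) (hT : 0 ≤ T) (h0 : u 0 ≤ 0)
    (hs : ∀ t, 0 ≤ t → t < T → u t = 0 → ∀ᶠ s in 𝓝[>] t, u s ≤ 0) : u T ≤ 0 := by
  have : Icc (0:ℝ) T ⊆ {t | u t ≤ 0} := by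
    refine IsClosed.Icc_subset_of_forall_mem_nhdsWithin ?_ h0 ?_
    · exact (isClosed_le hu continuous_const).inter isClosed_Icc
    · rintro t ⟨ht, ht0, htT⟩
      rcases lt_or_eq_of_le (show u t ≤ 0 from ht) with h | h
      · have : ∀ᶠ s in 𝓝 t, u s < 0 := hu.continuousAt.eventually (gt_mem_nhds h)
        filter_upwards [mem_nhdsWithin_of_mem_nhds this] with s hs using le_of_lt hs
      · exact hs t ht0 htT h
  exact this ⟨hT, le_rfl⟩

/-- Uniform decrease of `U` along the flow in the band `a ≤ U ≤ b`. -/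
def Band {E : Type*} (ψ : ℝ → E → E) (U : E → ℝ) (a b : ℝ) : Prop :=
  ∃ κ : ℝ, 0 < κ ∧ ∀ y, a ≤ U y → U y ≤ b → ∀ᶠ s in 𝓝[>] (0:ℝ), U (ψ s y) < U y - κ * s

section BandSec
variable {E : Type*} [NormedAddCommGroup E] [NormedSpace ℝ E]

lemma shift_right {P : ℝ → Prop} {t : ℝ} (h : ∀ᶠ s in 𝓝[>] (0:ℝ), P s) :
    ∀ᶠ s in 𝓝[>] t, P (s - t) := by
  have : Tendsto (fun s : ℝ => s - t) (𝓝[>] t) (𝓝[>] 0) := by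
    apply tendsto_nhdsWithin_of_tendsto_nhds_of_eventually_within
    · have : Tendsto (fun s : ℝ => s - t) (𝓝 t) (𝓝 (t - t)) :=
        (continuous_id.sub continuous_const).continuousAt
      rw [sub_self] at this
      exact this.mono_left nhdsWithin_le_nhds
    · filter_upwards [self_mem_nhdsWithin] with s hs
      simpa using hs
  exact this.eventually h

lemma band_inv {f : E → E} {ψ : ℝ → E → E} (H : IsFlow f ψ) {U : E → ℝ} (hU : Continuous U)
    {a b : ℝ} (hB : Band ψ U a b) {c : ℝ} (hac : a ≤ c) (hcb : c ≤ b) {y : E} (hy : U y ≤ c)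
    {t : ℝ} (ht : 0 ≤ t) : U (ψ t y) ≤ c := by
  obtain ⟨κ, hκ, hB⟩ := hB
  have := barrier (fun t => U (ψ t y) - c) ((hU.comp (H.cont_time y)).sub continuous_const) t ht
    (by simpa [H.zero] using hy) ?_
  · linarith
  intro s hs _ hsc
  have hsc' : U (ψ s y) = c := by linarith
  have := shift_right (t := s) (hB (ψ s y) (by linarith) (by linarith))
  filter_upwards [this, self_mem_nhdsWithin] with r hr hr'
  rw [← H.add, sub_add_cancel] at hr
  have : 0 < r - s := by simpa using hr'
  nlinarith

lemma band_dec {f : E → E} {ψ : ℝ → E → E} (H : IsFlow f ψ) {U : E → ℝ} (hU : Continuous U)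
    {a b κ : ℝ} (hB : ∀ y, a ≤ U y → U y ≤ b → ∀ᶠ s in 𝓝[>] (0:ℝ), U (ψ s y) < U y - κ * s)
    {y : E} {T : ℝ} (hT : 0 ≤ T)
    (h : ∀ t, 0 ≤ t → t ≤ T → a ≤ U (ψ t y) ∧ U (ψ t y) ≤ b) :
    U (ψ T y) ≤ U y - κ * T := by
  have := barrier (fun t => U (ψ t y) - U y + κ * t)
    (((hU.comp (H.cont_time y)).sub continuous_const).add (continuous_const.mul continuous_id)) T hT
    (by simp [H.zero]) ?_
  · linarith
  intro s hs hsT hsc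
  have := shift_right (t := s) (hB (ψ s y) (h s hs hsT.le).1 (h s hs hsT.le).2)
  filter_upwards [this, self_mem_nhdsWithin] with r hr hr'
  rw [← H.add, sub_add_cancel] at hr
  linarith

lemma band_inv_strict {f : E → E} {ψ : ℝ → E → E} (H : IsFlow f ψ) {U : E → ℝ} (hU : Continuous U)
    {a b : ℝ} (hB : Band ψ U a b) {c : ℝ} (hac : a < c) (hcb : c ≤ b) {y : E} (hy : U y ≤ c)
    {t : ℝ} (ht : 0 < t) : U (ψ t y) < c := by
  obtain ⟨t1, h1, h2, h3⟩ : ∃ t1, 0 ≤ t1 ∧ t1 ≤ t ∧ U (ψ t1 y) < c := by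
    rcases lt_or_eq_of_le hy with h | h
    · exact ⟨0, le_rfl, ht.le, by rwa [H.zero]⟩
    · obtain ⟨κ, hκ, hB'⟩ := hB
      obtain ⟨s, hs, hs'⟩ := ((hB' y (by linarith) (by linarith)).and
        (Ioo_mem_nhdsGT ht)).exists
      exact ⟨s, hs'.1.le, hs'.2.le, by nlinarith [hs'.1]⟩
  have := band_inv H hU hB (c := max a (U (ψ t1 y))) (le_max_left _ _)
    (by rw [max_le_iff]; constructor <;> linarith) (le_max_right _ _) (t := t - t1) (by linarith)
  rw [← H.add, sub_add_cancel] at this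
  exact this.trans_lt (max_lt hac h3)

lemma band_enter {f : E → E} {ψ : ℝ → E → E} (H : IsFlow f ψ) {U : E → ℝ} (hU : Continuous U)
    {a b : ℝ} (hab : a ≤ b) (hB : Band ψ U a b) {y : E} (hy : U y ≤ b) :
    ∃ t, 0 ≤ t ∧ U (ψ t y) ≤ a := by
  by_contra! hcon
  obtain ⟨κ, hκ, hB'⟩ := hB
  have hT : 0 ≤ (b - a) / κ := div_nonneg (by linarith) hκ.le
  have := band_dec H hU hB' (T := (b - a) / κ) (y := y) hT (fun t ht _ => ⟨(hcon t ht).le,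
    band_inv H hU ⟨κ, hκ, hB'⟩ hab le_rfl hy ht⟩)
  have h2 : κ * ((b - a) / κ) = b - a := by field_simp
  linarith [hcon _ hT]

lemma band_back {f : E → E} {ψ : ℝ → E → E} (H : IsFlow f ψ) {U : E → ℝ} (hU : Continuous U)
    {a b : ℝ} (hab : a ≤ b) (hB : Band ψ U a b) {y : E} (hy : a < U y) :
    ∃ t, 0 ≤ t ∧ b ≤ U (ψ (-t) y) := by
  by_contra! hcon
  obtain ⟨κ, hκ, hB'⟩ := hB
  have hT : 0 ≤ (b - a) / κ := div_nonneg (by linarith) hκ.le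
  set T := (b - a) / κ
  have key : ∀ t, ψ t (ψ (-T) y) = ψ (-(T - t)) y := by
    intro t; rw [← H.add]; congr 1; ring
  have := band_dec H hU hB' (T := T) (y := ψ (-T) y) hT (fun t ht htT => ⟨?_, ?_⟩)
  · have h2 : κ * T = b - a := by simp only [T]; field_simp
    rw [key, sub_self, neg_zero, H.zero] at this
    linarith [hcon _ hT]
  · by_contra! hlt
    have := band_inv H hU ⟨κ, hκ, hB'⟩ le_rfl hab hlt.le (t := T - t) (by linarith)
    rw [← H.add, ← H.add] at this
    have e : T - t + t + -T = 0 := by ring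
    rw [e, H.zero] at this
    linarith
  · rw [key]
    exact (hcon _ (by linarith)).le

lemma band_nhds {f : E → E} {ψ : ℝ → E → E} (H : IsFlow f ψ) {U : E → ℝ} (hU : Continuous U)
    {a b : ℝ} (hab : a < b) (hB : Band ψ U a b) {y : E} (hy : U y ≤ a) :
    ∀ᶠ z in 𝓝 y, U (ψ 1 z) ≤ a := by
  obtain ⟨κ, hκ, hB'⟩ := hB
  have : ∀ᶠ z in 𝓝 y, U z < min b (a + κ) :=
    hU.continuousAt.eventually (gt_mem_nhds (lt_min (by linarith) (by linarith)))
  filter_upwards [this] with z hz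
  have hz1 := hz.trans_le (min_le_left _ _)
  have hz2 := hz.trans_le (min_le_right _ _)
  by_contra! hlt
  have key : ∀ t, 0 ≤ t → t ≤ 1 → a < U (ψ t z) := by
    intro t ht ht1
    by_contra! hle
    have := band_inv H hU ⟨κ, hκ, hB'⟩ le_rfl hab.le hle (t := 1 - t) (by linarith)
    rw [← H.add, sub_add_cancel] at this
    linarith
  have := band_dec H hU hB' (T := 1) (y := z) zero_le_one (fun t ht htT => ⟨(key t ht htT).le,
    band_inv H hU ⟨κ, hκ, hB'⟩ hab.le le_rfl hz1.le ht⟩)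
  linarith

end BandSec

local notation "E2" => EuclideanSpace ℝ (Fin 2)

lemma diverg_eq (f : E2 → E2) (x : E2) :
    diverg f x = (fderiv ℝ f x (EuclideanSpace.single 0 1)) 0 +
      (fderiv ℝ f x (EuclideanSpace.single 1 1)) 1 := by
  unfold diverg
  rw [LinearMap.trace_eq_matrix_trace ℝ (EuclideanSpace.basisFun (Fin 2) ℝ).toBasis]
  simp [Matrix.trace, Fin.sum_univ_two, LinearMap.toMatrix_apply]

lemma diverg_cont (f : E2 → E2) (hf : ContDiff ℝ 1 f) : Continuous (diverg f) := by
  have h1 : Continuous (fderiv ℝ f) := hf.continuous_fderiv one_ne_zero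
  have : diverg f = fun x => (fderiv ℝ f x (EuclideanSpace.single 0 1)) 0 +
      (fderiv ℝ f x (EuclideanSpace.single 1 1)) 1 := by
    ext x; exact diverg_eq f x
  rw [this]
  fun_prop

lemma trace_identity (f : E2 → E2) (x u w : E2) :
    inner ℝ u (fderiv ℝ f x u) * ‖w‖^2 + ‖u‖^2 * inner ℝ w (fderiv ℝ f x w) =
      diverg f x * (‖u‖^2 * ‖w‖^2 - (inner ℝ u w)^2) +
      inner ℝ u w * (inner ℝ u (fderiv ℝ f x w) + inner ℝ w (fderiv ℝ f x u)) := by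
  rw [diverg_eq]
  set A := fderiv ℝ f x
  have hdec : ∀ v : E2, v = v 0 • EuclideanSpace.single 0 1 + v 1 • EuclideanSpace.single 1 1 := by
    intro v; ext i; fin_cases i <;> simp
  have hA : ∀ v : E2, ∀ i, (A v) i = v 0 * (A (EuclideanSpace.single 0 1)) i +
      v 1 * (A (EuclideanSpace.single 1 1)) i := by
    intro v i
    conv_lhs => rw [hdec v]
    simp
  simp only [EuclideanSpace.real_norm_sq_eq, PiLp.inner_apply, Fin.sum_univ_two, RCLike.inner_apply,
    conj_trivial]
  rw [hA u 0, hA u 1, hA w 0, hA w 1]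
  ring

lemma rate_ineq (f : E2 → E2) (x w e : E2) (c k m M L r : ℝ) (hc : 0 < c) (hk : 0 < k)
    (hm : 0 < m) (hL : 0 < L)
    (hmf : m ≤ ‖f x‖) (hfM : ‖f x‖ ≤ M) (hA : ‖fderiv ℝ f x‖ ≤ L) (hdiv : diverg f x ≤ -c)
    (hkm : c + 4 * L^2 / c ≤ k * m^2) (hw : ‖w‖ ≤ r) (hr : k * L * M * r ≤ c / 4)
    (he : ‖e‖ ≤ c / 4 * ‖w‖) (hw0 : w ≠ 0) :
    (1 + k * inner ℝ (f x) w) * inner ℝ (f x) (fderiv ℝ f x (f x)) * ‖w‖^2 +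
      ‖f x‖^2 * inner ℝ w ((f x + fderiv ℝ f x w + e) - (1 + k * inner ℝ (f x) w) • f x) < 0 := by
  have hid := trace_identity f x (f x) w
  set u := f x
  set A := fderiv ℝ f x
  set β : ℝ := inner ℝ u w with hβ
  have hw1 : 0 < ‖w‖ := norm_pos_iff.2 hw0
  have hu1 : 0 < ‖u‖ := by linarith
  have e1 : inner ℝ w ((u + A w + e) - (1 + k * β) • u) =
      inner ℝ w (A w) + inner ℝ w e - k * β * β := by
    rw [inner_sub_right, inner_add_right, inner_add_right, inner_smul_right,
      real_inner_comm u w]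
    simp only [← hβ]; ring
  rw [e1]
  have hβ1 : |β| ≤ ‖u‖ * ‖w‖ := abs_real_inner_le_norm u w
  have hAv : ∀ v, ‖A v‖ ≤ L * ‖v‖ := fun v =>
    (A.le_opNorm v).trans (mul_le_mul_of_nonneg_right hA (norm_nonneg _))
  have i1 : |inner ℝ u (A w)| ≤ L * (‖u‖ * ‖w‖) := by
    calc _ ≤ ‖u‖ * ‖A w‖ := abs_real_inner_le_norm _ _
      _ ≤ ‖u‖ * (L * ‖w‖) := by gcongr; exact hAv w
      _ = _ := by ring
  have i2 : |inner ℝ w (A u)| ≤ L * (‖u‖ * ‖w‖) := by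
    calc _ ≤ ‖w‖ * ‖A u‖ := abs_real_inner_le_norm _ _
      _ ≤ ‖w‖ * (L * ‖u‖) := by gcongr; exact hAv u
      _ = _ := by ring
  have i3 : |inner ℝ u (A u)| ≤ L * ‖u‖^2 := by
    calc _ ≤ ‖u‖ * ‖A u‖ := abs_real_inner_le_norm _ _
      _ ≤ ‖u‖ * (L * ‖u‖) := by gcongr; exact hAv u
      _ = _ := by ring
  have i4 : inner ℝ w e ≤ c / 4 * ‖w‖^2 := by
    calc _ ≤ ‖w‖ * ‖e‖ := real_inner_le_norm _ _
      _ ≤ ‖w‖ * (c / 4 * ‖w‖) := by gcongr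
      _ = _ := by ring
  set F : ℝ := ‖u‖ * ‖w‖ with hF
  have hF0 : 0 < F := mul_pos hu1 hw1
  have hβF : β^2 ≤ F^2 := sq_le_sq' (by linarith [neg_abs_le β]) (by linarith [le_abs_self β])
  have t1 : diverg f x * (‖u‖^2 * ‖w‖^2 - β^2) ≤ -c * (F^2 - β^2) := by
    have : ‖u‖^2 * ‖w‖^2 = F^2 := by rw [hF]; ring
    rw [this]
    exact mul_le_mul_of_nonneg_right hdiv (by linarith)
  have t2 : β * (inner ℝ u (A w) + inner ℝ w (A u)) ≤ c / 4 * F^2 + 4 * L^2 / c * β^2 := by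
    have a1 : β * (inner ℝ u (A w) + inner ℝ w (A u)) ≤ |β| * (2 * L * F) := by
      calc _ ≤ |β * (inner ℝ u (A w) + inner ℝ w (A u))| := le_abs_self _
        _ = |β| * |inner ℝ u (A w) + inner ℝ w (A u)| := abs_mul _ _
        _ ≤ |β| * (2 * L * F) := by
          gcongr
          refine (abs_add_le _ _).trans ?_
          linarith
    have a2 : |β| * (2 * L * F) ≤ c / 4 * F^2 + 4 * L^2 / c * |β|^2 := by
      have : 0 ≤ c / 4 * (F - 4 * L / c * |β|)^2 := by positivity
      have e : c / 4 * (F - 4 * L / c * |β|)^2 =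
        c / 4 * F^2 + 4 * L^2 / c * |β|^2 - |β| * (2 * L * F) := by field_simp; ring
      linarith
    rw [sq_abs] at a2
    linarith
  have hβ2 : |β| ≤ M * r := hβ1.trans (mul_le_mul hfM hw (norm_nonneg _) (by linarith))
  have hk2 : 0 ≤ k * (M * r) := mul_nonneg hk.le ((abs_nonneg β).trans hβ2)
  have t3 : k * β * inner ℝ u (A u) * ‖w‖^2 ≤ c / 4 * F^2 := by
    have a1 : k * β * inner ℝ u (A u) ≤ c / 4 * ‖u‖^2 := by
      calc k * β * inner ℝ u (A u) ≤ |k * β * inner ℝ u (A u)| := le_abs_self _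
        _ = k * |β| * |inner ℝ u (A u)| := by rw [abs_mul, abs_mul, abs_of_pos hk]
        _ ≤ k * (M * r) * (L * ‖u‖^2) := by
          gcongr
        _ = (k * L * M * r) * ‖u‖^2 := by ring
        _ ≤ c / 4 * ‖u‖^2 := by gcongr
    calc _ ≤ c / 4 * ‖u‖^2 * ‖w‖^2 := by gcongr
      _ = _ := by rw [hF]; ring
  have t4 : ‖u‖^2 * inner ℝ w e ≤ c / 4 * F^2 := by
    calc _ ≤ ‖u‖^2 * (c / 4 * ‖w‖^2) := by gcongr
      _ = _ := by rw [hF]; ring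
  have t5 : (c + 4 * L^2 / c) * β^2 ≤ ‖u‖^2 * (k * β * β) := by
    calc _ ≤ (k * m^2) * β^2 := by gcongr
      _ ≤ (k * ‖u‖^2) * β^2 := by gcongr
      _ = _ := by ring
  have : 0 < c / 4 * F^2 := by positivity
  nlinarith

lemma uniform_taylor (f : E2 → E2) (hf : ContDiff ℝ 1 f) (C : Set E2) (hC : IsCompact C)
    (ε : ℝ) (hε : 0 < ε) : ∃ r > 0, ∀ x ∈ C, ∀ w : E2, ‖w‖ < r →
      ‖f (x + w) - f x - fderiv ℝ f x w‖ ≤ ε * ‖w‖ := by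
  have h1 : Continuous (fderiv ℝ f) := hf.continuous_fderiv one_ne_zero
  have h2 := hC.uniformContinuousAt_of_continuousAt (fderiv ℝ f) (fun a _ => h1.continuousAt)
    (Metric.dist_mem_uniformity hε)
  obtain ⟨r, hr, h3⟩ := Metric.mem_uniformity_dist.1 h2
  refine ⟨r, hr, fun x hx w hw => ?_⟩
  have hd : Differentiable ℝ f := hf.differentiable one_ne_zero
  have := (convex_ball x r).norm_image_sub_le_of_norm_hasFDerivWithin_le' (f := f)
    (f' := fderiv ℝ f) (φ := fderiv ℝ f x) (C := ε) (x := x) (y := x + w)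
    (fun y _ => (hd y).hasFDerivAt.hasFDerivWithinAt)
    (fun y hy => by
      have := h3 (a := x) (b := y) (by rw [dist_comm]; exact hy) hx
      rw [← dist_eq_norm, dist_comm]; exact le_of_lt this)
    (Metric.mem_ball_self hr) (by simpa using hw)
  simpa using this

/-- A compact forward invariant set without equilibria on which the divergence is negative
is Lyapunov stable. -/
lemma stable_set (f : E2 → E2) (hf : ContDiff ℝ 1 f) (ψ : ℝ → E2 → E2) (H : IsFlow f ψ)
    (C : Set E2) (hC : IsCompact C) (hinv : ∀ x ∈ C, ∀ t, 0 ≤ t → ψ t x ∈ C)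
    (hne : ∀ x ∈ C, f x ≠ 0) (hdiv : ∀ x ∈ C, diverg f x < 0) (O : Set E2) (hO : IsOpen O)
    (hCO : C ⊆ O) (x0 : E2) (hx0 : x0 ∈ C) :
    ∀ᶠ z in 𝓝 x0, ∀ t, 0 ≤ t → ψ t z ∈ O := by
  have hCne : C.Nonempty := ⟨x0, hx0⟩
  have hfd : Continuous (fderiv ℝ f) := hf.continuous_fderiv one_ne_zero
  have hfc : Continuous f := hf.continuous
  -- constants
  obtain ⟨xm, hxm, hmin⟩ := hC.exists_isMinOn hCne hfc.norm.continuousOn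
  have hm : 0 < ‖f xm‖ := norm_pos_iff.2 (hne xm hxm)
  set m := ‖f xm‖
  have hmf : ∀ x ∈ C, m ≤ ‖f x‖ := fun x hx => hmin hx
  obtain ⟨xM, hxM, hmax⟩ := hC.exists_isMaxOn hCne hfc.norm.continuousOn
  set M := ‖f xM‖
  have hfM : ∀ x ∈ C, ‖f x‖ ≤ M := fun x hx => hmax hx
  have hM : 0 < M := hm.trans_le (hfM xm hxm)
  obtain ⟨xL, hxL, hLmax⟩ := hC.exists_isMaxOn hCne hfd.norm.continuousOn
  obtain ⟨L, hL, hAL⟩ : ∃ L : ℝ, 0 < L ∧ ∀ x ∈ C, ‖fderiv ℝ f x‖ ≤ L :=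
    ⟨‖fderiv ℝ f xL‖ + 1, by positivity, fun x hx => by
      have : ‖fderiv ℝ f x‖ ≤ ‖fderiv ℝ f xL‖ := hLmax hx
      linarith⟩
  obtain ⟨xc, hxc, hcmax⟩ := hC.exists_isMaxOn hCne (diverg_cont f hf).continuousOn
  obtain ⟨c, hc, hcd⟩ : ∃ c : ℝ, 0 < c ∧ ∀ x ∈ C, diverg f x ≤ -c :=
    ⟨-diverg f xc, by linarith [hdiv xc hxc], fun x hx => by
      have : diverg f x ≤ diverg f xc := hcmax hx
      linarith⟩
  obtain ⟨k, hk, hkm⟩ : ∃ k : ℝ, 0 < k ∧ c + 4 * L^2 / c ≤ k * m^2 :=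
    ⟨(c + 4 * L^2 / c) / m^2, by positivity, by
      rw [div_mul_cancel₀ _ (by positivity)]⟩
  obtain ⟨r1, hr1, htay⟩ := uniform_taylor f hf C hC (c / 4) (by positivity)
  obtain ⟨r2, hr2, hr2'⟩ : ∃ r : ℝ, 0 < r ∧ k * L * M * r ≤ c / 4 :=
    ⟨c / 4 / (k * L * M), by positivity, by
      rw [mul_div_cancel₀ _ (by positivity)]⟩
  obtain ⟨r3, hr3, hr3'⟩ : ∃ r : ℝ, 0 < r ∧ k * M * r ≤ 1 :=
    ⟨1 / (k * M), by positivity, by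
      rw [mul_div_cancel₀ _ (by positivity)]⟩
  obtain ⟨ε, hε, hεO⟩ := hC.exists_thickening_subset_open hO hCO
  set ρ := min (min r1 r2) (min r3 ε)
  have hρ : 0 < ρ := lt_min (lt_min hr1 hr2) (lt_min hr3 hε)
  have hρ1 : ρ ≤ r1 := (min_le_left _ _).trans (min_le_left _ _)
  have hρ2 : ρ ≤ r2 := (min_le_left _ _).trans (min_le_right _ _)
  have hρ3 : ρ ≤ r3 := (min_le_right _ _).trans (min_le_left _ _)
  have hρ4 : ρ ≤ ε := (min_le_right _ _).trans (min_le_right _ _)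
  let V : E2 → E2 → ℝ := fun z x => ‖f x‖^2 * ‖z - x‖^2
  have hVc : Continuous ↿V := by
    simp only [V, Function.HasUncurry.uncurry]
    fun_prop
  let D : E2 → ℝ := fun z => sInf (V z '' C)
  have hDc : Continuous D := hC.continuous_sInf hVc
  have hDle : ∀ z, ∀ x ∈ C, D z ≤ V z x := by
    intro z x hx
    refine csInf_le ⟨0, ?_⟩ (mem_image_of_mem _ hx)
    rintro _ ⟨y, _, rfl⟩
    simp only [V]; positivity
  have hDmin : ∀ z, ∃ x ∈ C, V z x = D z := by
    intro z
    have hVz : Continuous (V z) := by simp only [V]; fun_prop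
    have := (hC.image hVz).sInf_mem (hCne.image _)
    exact this
  set d := m^2 * ρ^2 / 4 with hd
  have hdpos : 0 < d := by positivity
  have hVsmall : ∀ z, ∀ x ∈ C, V z x ≤ d → ‖z - x‖ < ρ := by
    intro z x hx hV
    have h1 : m^2 * ‖z - x‖^2 ≤ V z x := by
      simp only [V]
      gcongr
      exact hmf x hx
    have h2 : ‖z - x‖^2 ≤ ρ^2 / 4 := by
      have : m^2 * ‖z - x‖^2 ≤ m^2 * (ρ^2 / 4) := by linarith
      exact le_of_mul_le_mul_left this (by positivity)
    have : ‖z - x‖^2 < ρ^2 := by nlinarith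
    exact lt_of_pow_lt_pow_left₀ 2 hρ.le this
  have hD0 : D x0 < d := by
    have := hDle x0 x0 hx0
    simp only [V, sub_self, norm_zero] at this
    linarith
  filter_upwards [hDc.continuousAt.eventually (gt_mem_nhds hD0)] with z hz t ht
  have hDt : D (ψ t z) ≤ d := by
    have := barrier (fun t => D (ψ t z) - d) ((hDc.comp (H.cont_time z)).sub continuous_const) t ht
      (by simpa [H.zero] using hz.le) ?_
    · linarith
    intro s _ _ hsd
    have hsd' : D (ψ s z) = d := by linarith
    obtain ⟨x, hx, hVx⟩ := hDmin (ψ s z)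
    set y := ψ s z
    set w := y - x with hw
    have hwρ : ‖w‖ < ρ := hVsmall y x hx (by linarith)
    have hw0 : w ≠ 0 := by
      intro h0
      have : V y x = 0 := by simp only [V, ← hw, h0, norm_zero]; ring
      linarith
    set σ : ℝ := 1 + k * inner ℝ (f x) w with hσ
    have hσ0 : 0 ≤ σ := by
      have h1 : |inner ℝ (f x) w| ≤ M * r3 :=
        (abs_real_inner_le_norm _ _).trans
          (mul_le_mul (hfM x hx) (hwρ.le.trans hρ3) (norm_nonneg _) hM.le)
      have h2 := neg_abs_le (inner ℝ (f x) w)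
      have : k * (-(M * r3)) ≤ k * inner ℝ (f x) w := by
        apply mul_le_mul_of_nonneg_left _ hk.le
        linarith
      simp only [hσ]
      linarith
    have hrate := rate_ineq f x w (f y - f x - fderiv ℝ f x w) c k m M L ρ hc hk hm hL (hmf x hx)
      (hfM x hx) (hAL x hx) (hcd x hx) hkm hwρ.le
      (le_trans (by gcongr) hr2')
      (by
        have := htay x hx w (hwρ.trans_le hρ1)
        rwa [hw, add_sub_cancel] at this) hw0
    rw [← hσ, show f x + fderiv ℝ f x w + (f y - f x - fderiv ℝ f x w) = f y by abel] at hrate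
    -- the comparison curve
    let v : ℝ → ℝ := fun τ => V (ψ τ y) (ψ (σ * τ) x)
    have hx1 : HasDerivAt (fun τ => ψ (σ * τ) x) (σ • f x) 0 := by
      have h1 : HasDerivAt (fun τ : ℝ => σ * τ) σ 0 := by
        simpa using (hasDerivAt_id (0:ℝ)).const_mul σ
      have h2 : HasDerivAt (fun s => ψ s x) (f x) (σ * 0) := by
        rw [mul_zero]
        have := H.deriv 0 x
        rwa [H.zero] at this
      exact h2.scomp 0 h1
    have hy1 : HasDerivAt (fun τ => ψ τ y) (f y) 0 := by
      have := H.deriv 0 y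
      rwa [H.zero] at this
    have hfx1 : HasDerivAt (fun τ => f (ψ (σ * τ) x)) (fderiv ℝ f x (σ • f x)) 0 := by
      have hd : HasFDerivAt f (fderiv ℝ f x) (ψ (σ * 0) x) := by
        rw [mul_zero, H.zero]
        exact (hf.differentiable one_ne_zero x).hasFDerivAt
      exact hd.comp_hasDerivAt 0 hx1
    have hv : HasDerivAt v (2 * (σ * inner ℝ (f x) (fderiv ℝ f x (f x)) * ‖w‖^2 +
        ‖f x‖^2 * inner ℝ w (f y - σ • f x))) 0 := by
      have := hfx1.norm_sq.mul (hy1.sub hx1).norm_sq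
      simp only [mul_zero, H.zero] at this
      refine this.congr_deriv ?_
      simp only [Pi.sub_apply, mul_zero, H.zero, map_smul, inner_smul_right, ← hw]
      ring
    have hev : ∀ᶠ τ in 𝓝[>] (0:ℝ), slope v 0 τ < 0 :=
      (hv.hasDerivWithinAt (s := Ioi 0)).limsup_slope_le' (by simp) (by linarith)
    have := shift_right (t := s) hev
    filter_upwards [this, self_mem_nhdsWithin] with τ hτ hτ'
    have hpos : 0 < τ - s := by simpa using hτ'
    have hv0 : v 0 = d := by
      simp only [v, mul_zero, H.zero]; linarith
    have hvlt : v (τ - s) < d := by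
      rw [slope_def_field, sub_zero, div_neg_iff] at hτ
      rcases hτ with h | h <;> linarith [h.1, h.2]
    have := hDle (ψ (τ - s) y) (ψ (σ * (τ - s)) x) (hinv x hx _ (by positivity))
    rw [show ψ (τ - s) y = ψ τ z by simp only [y]; rw [← H.add, sub_add_cancel]] at this
    have h4 : v (τ - s) = V (ψ τ z) (ψ (σ * (τ - s)) x) := by
      simp only [v, y]; rw [← H.add, sub_add_cancel]
    linarith
  obtain ⟨x, hx, hVx⟩ := hDmin (ψ t z)
  apply hεO
  rw [Metric.mem_thickening_iff]
  exact ⟨x, hx, by rw [dist_eq_norm]; exact (hVsmall _ x hx (by linarith)).trans_le hρ4⟩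

/-- Along an orbit piece staying in a set where the divergence does not vanish, its sign is
constant. -/
lemma sign_const {f : E2 → E2} (hf : ContDiff ℝ 1 f) {ψ : ℝ → E2 → E2} (H : IsFlow f ψ)
    {x : E2} {T : ℝ} (hx : ∀ t, T ≤ t → diverg f (ψ t x) ≠ 0) {s : ℝ} (hs : T ≤ s)
    (hpos : 0 < diverg f (ψ s x)) : ∀ t, T ≤ t → 0 < diverg f (ψ t x) := by
  intro t ht
  by_contra! hcon
  have hc : ContinuousOn (fun t => diverg f (ψ t x)) (Ici T) :=
    ((diverg_cont f hf).comp (H.cont_time x)).continuousOn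
  obtain ⟨r, hr, hr0⟩ := isPreconnected_Ici.intermediate_value (a := t) (b := s) ht hs hc
    (show (0:ℝ) ∈ Icc _ _ from ⟨hcon, hpos.le⟩)
  exact hx r hr hr0

lemma no_attractor (f : E2 → E2) (hf : ContDiff ℝ 1 f) (ψ : ℝ → E2 → E2) (H : IsFlow f ψ)
    (R : Set E2) (hRc : IsCompact R) (hRne : ∀ x ∈ R, diverg f x ≠ 0 ∧ f x ≠ 0)
    (O : Set E2) (hO : IsOpen O) (hOinv : ∀ x ∈ O, ∀ t, 0 ≤ t → ψ t x ∈ O)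
    (hRO : ∀ x ∈ R, x ∉ O) (W : Set E2) (hW : IsOpen W)
    (hRW : ∀ x, (∀ t, 0 ≤ t → ψ t x ∈ R) → x ∈ W)
    (hOW : ∀ x ∈ O, ∃ t, 0 ≤ t ∧ ψ t x ∉ W)
    (Q : Set E2) (hQinv : ∀ x ∈ Q, ∀ t, 0 ≤ t → ψ t x ∈ Q)
    (hQR : ∀ x ∈ Q, (∀ t, 0 ≤ t → ψ t x ∉ O) → x ∈ R)
    (hQn : ∀ x ∈ Q, ∀ᶠ z in 𝓝 x, ψ 1 z ∈ Q)
    (X : Set E2) (hX : IsPreconnected X) (hXQ : ∀ x ∈ X, ∃ T, 0 ≤ T ∧ ψ T x ∈ Q)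
    (x0 : E2) (hx0 : x0 ∈ X) (hx0O : x0 ∈ O) (x : E2) (hx : x ∈ X) (T0 : ℝ) (hT0 : 0 ≤ T0)
    (hxC : ∀ t, 0 ≤ t → ψ t (ψ T0 x) ∈ R ∧ diverg f (ψ t (ψ T0 x)) ≤ 0) : False := by
  set C : Set E2 := {x | ∀ t, 0 ≤ t → ψ t x ∈ R ∧ diverg f (ψ t x) ≤ 0} with hCdef
  have hdc := diverg_cont f hf
  have hCR : C ⊆ R := fun y hy => by simpa [H.zero] using (hy 0 le_rfl).1
  have hCcl : IsClosed C := by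
    have : C = ⋂ t : ℝ, ⋂ _ : 0 ≤ t, (ψ t ⁻¹' (R ∩ {z | diverg f z ≤ 0})) := by
      ext z; simp [hCdef]
    rw [this]
    refine isClosed_iInter fun t => isClosed_iInter fun _ => IsClosed.preimage (H.cont t) ?_
    exact hRc.isClosed.inter (isClosed_le hdc continuous_const)
  have hCc : IsCompact C := hRc.of_isClosed_subset hCcl hCR
  have hCinv : ∀ x ∈ C, ∀ t, 0 ≤ t → ψ t x ∈ C := by
    intro y hy t ht s hs
    rw [← H.add]
    exact hy _ (by positivity)
  have hCneg : ∀ y ∈ C, diverg f y < 0 := by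
    intro y hy
    have h1 := (hy 0 le_rfl).2
    rw [H.zero] at h1
    exact lt_of_le_of_ne h1 (hRne y (hCR hy)).1
  have hCW : C ⊆ W ∩ {z | diverg f z < 0} := fun y hy =>
    ⟨hRW y fun t ht => (hy t ht).1, hCneg y hy⟩
  have hOpen : IsOpen (W ∩ {z | diverg f z < 0}) := hW.inter (isOpen_lt hdc continuous_const)
  set B : Set E2 := {x | ∃ T, 0 ≤ T ∧ ψ T x ∈ C} with hBdef
  -- points of `B` never meet `O`
  have hBO : ∀ y ∈ B, ∀ t, 0 ≤ t → ψ t y ∉ O := by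
    rintro y ⟨T, hT, hy⟩ t ht hyO
    have h1 : ψ T (ψ t y) ∈ O := hOinv _ hyO T hT
    rw [← H.add, add_comm, H.add] at h1
    exact hRO _ (hCR (hCinv _ hy t ht)) h1
  -- orbits in `Q` never meeting `O` lie in `R`
  have hstay : ∀ y T, 0 ≤ T → ψ T y ∈ Q → (∀ t, 0 ≤ t → ψ t y ∉ O) → ∀ t, T ≤ t → ψ t y ∈ R := by
    intro y T hT hyQ hyO t ht
    have h1 : ψ t y ∈ Q := by
      have := hQinv _ hyQ (t - T) (by linarith)
      rwa [← H.add, sub_add_cancel] at this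
    refine hQR _ h1 fun s hs => ?_
    rw [← H.add]
    exact hyO _ (by linarith)
  have hB1 : ∀ y ∈ X ∩ B, ∀ᶠ z in 𝓝 y, z ∈ X → z ∈ B := by
    rintro y ⟨hyX, T, hT, hyC⟩
    have h1 := stable_set f hf ψ H C hCc hCinv (fun z hz => (hRne z (hCR hz)).2) hCneg _ hOpen hCW
      _ hyC
    have h2 := (H.cont T).continuousAt.eventually h1
    filter_upwards [h2] with z hz hzX
    obtain ⟨T', hT', hzQ⟩ := hXQ z hzX
    have hnO : ∀ t, 0 ≤ t → ψ t z ∉ O := by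
      intro t ht htO
      have h3 : ψ T (ψ t z) ∈ O := hOinv _ htO T hT
      obtain ⟨s, hs, hsW⟩ := hOW _ h3
      apply hsW
      have := (hz (s + t) (by linarith)).1
      rw [← H.add] at this
      rw [← H.add, ← H.add]
      convert this using 2
      ring
    have hR := hstay z T' hT' hzQ hnO
    refine ⟨max T T', le_max_of_le_left hT, fun t ht => ?_⟩
    rw [← H.add]
    have e1 := le_max_left T T'
    have e2 := le_max_right T T'
    refine ⟨hR _ (by linarith), ?_⟩
    have := (hz (t + max T T' - T) (by linarith)).2
    rw [← H.add, sub_add_cancel] at this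
    exact le_of_lt this
  have hB2 : ∀ y ∈ X \ B, ∀ᶠ z in 𝓝 y, z ∈ X → z ∉ B := by
    rintro y ⟨hyX, hyB⟩
    by_cases hyO : ∃ t, 0 ≤ t ∧ ψ t y ∈ O
    · obtain ⟨t, ht, hyO⟩ := hyO
      filter_upwards [(H.cont t).continuousAt.eventually (hO.mem_nhds hyO)] with z hz _ hzB
      exact hBO z hzB t ht hz
    · push Not at hyO
      obtain ⟨T, hT, hyQ⟩ := hXQ y hyX
      have hR := hstay y T hT hyQ hyO
      have hdiv : ∀ t, T ≤ t → diverg f (ψ t y) ≠ 0 := fun t ht => (hRne _ (hR t ht)).1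
      have hpos : 0 < diverg f (ψ (T+1) y) := by
        by_contra! hneg
        apply hyB
        refine ⟨T, hT, fun t ht => ?_⟩
        rw [← H.add]
        refine ⟨hR _ (by linarith), ?_⟩
        by_contra! hp
        exact absurd (sign_const hf H hdiv (s := t + T) (by linarith) hp (T+1) (by linarith))
          (not_lt.2 hneg)
      have h1 : ∀ᶠ z in 𝓝 y, ψ 1 (ψ T z) ∈ Q :=
        (H.cont T).continuousAt.eventually (hQn _ hyQ)
      have h2 : ∀ᶠ z in 𝓝 y, 0 < diverg f (ψ (T+1) z) :=
        (hdc.comp (H.cont (T+1))).continuousAt.eventually (lt_mem_nhds hpos)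
      filter_upwards [h1, h2] with z hz1 hz2 _ hzB
      rw [← H.add, add_comm] at hz1
      have hRz := hstay z (T+1) (by linarith) hz1 (hBO z hzB)
      have hsg := sign_const hf H (fun t ht => (hRne _ (hRz t ht)).1) le_rfl hz2
      obtain ⟨S, hS, hzC⟩ := hzB
      have e1 := le_max_left S (T+1)
      have e2 := le_max_right S (T+1)
      have h3 := hsg (max S (T+1)) e2
      have h4 := (hzC (max S (T+1) - S) (by linarith)).2
      rw [← H.add, sub_add_cancel] at h4
      linarith
  have hpc := hX (interior {z | z ∈ X → z ∈ B}) (interior {z | z ∈ X → z ∉ B}) isOpen_interior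
    isOpen_interior
    (fun y hy => by
      by_cases hyB : y ∈ B
      · exact Or.inl (mem_interior_iff_mem_nhds.2 (hB1 y ⟨hy, hyB⟩))
      · exact Or.inr (mem_interior_iff_mem_nhds.2 (hB2 y ⟨hy, hyB⟩)))
    ⟨x, hx, mem_interior_iff_mem_nhds.2 (hB1 x ⟨hx, T0, hT0, hxC⟩)⟩
    ⟨x0, hx0, mem_interior_iff_mem_nhds.2 (hB2 x0 ⟨hx0, fun hB => by
      refine hBO x0 hB 0 le_rfl ?_
      rwa [H.zero]⟩)⟩
  obtain ⟨z, hzX, hz1, hz2⟩ := hpc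
  exact interior_subset hz2 hzX (interior_subset hz1 hzX)

lemma dini_rate {U : E2 → ℝ} (hLip : LocallyLipschitzOnSet U (({(0 : E2)} : Set E2)ᶜ)) {y v : E2}
    (hy : y ≠ 0) {e : ℝ} (hd : dini U v y ≤ ((-e : ℝ) : EReal)) (x : ℝ → E2) (hx0 : x 0 = y)
    (hxd : HasDerivAt x v 0) {r : ℝ} (hr : -e < r) :
    ∀ᶠ s in 𝓝[>] (0:ℝ), U (x s) < U y + r * s := by
  obtain ⟨r', h1, h2⟩ := exists_between hr
  have hlim : ∀ᶠ s in 𝓝[>] (0:ℝ), (((U (y + s • v) - U y) / s : ℝ) : EReal) < (r' : EReal) :=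
    eventually_lt_of_limsup_lt (lt_of_le_of_lt hd (by exact_mod_cast h1))
  obtain ⟨K, t, ht, hK⟩ := hLip y hy
  rw [isOpen_compl_singleton.nhdsWithin_eq hy] at ht
  have hx1 : ∀ᶠ s in 𝓝[>] (0:ℝ), x s ∈ t := by
    have : Tendsto x (𝓝 0) (𝓝 y) := by
      have := hxd.continuousAt.tendsto
      rwa [hx0] at this
    exact (this.mono_left nhdsWithin_le_nhds).eventually ht
  have hx2 : ∀ᶠ s in 𝓝[>] (0:ℝ), y + s • v ∈ t := by
    have hc : Continuous (fun s : ℝ => y + s • v) := by fun_prop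
    have : Tendsto (fun s : ℝ => y + s • v) (𝓝 0) (𝓝 y) := by
      have := hc.tendsto 0
      simpa using this
    exact (this.mono_left nhdsWithin_le_nhds).eventually ht
  have hε : 0 < (r - r') / (K + 1) := div_pos (by linarith) (by positivity)
  have hlo := (hasDerivAt_iff_isLittleO.1 hxd).def hε
  have hlo' := hlo.filter_mono (nhdsWithin_le_nhds (s := Ioi (0:ℝ)))
  filter_upwards [hlim, hx1, hx2, hlo', self_mem_nhdsWithin] with s h3 h4 h5 h6 h7
  have hs : 0 < s := h7
  have h3' : (U (y + s • v) - U y) / s < r' := by exact_mod_cast h3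
  rw [div_lt_iff₀ hs] at h3'
  have h8 := hK.dist_le_mul _ h4 _ h5
  rw [Real.dist_eq, dist_eq_norm] at h8
  have h9 : ‖x s - (y + s • v)‖ ≤ (r - r') / (K + 1) * s := by
    rw [hx0, sub_zero, Real.norm_of_nonneg hs.le] at h6
    rwa [← sub_sub]
  have h10 : (K:ℝ) * ‖x s - (y + s • v)‖ ≤ (r - r') * s := by
    calc (K:ℝ) * ‖x s - (y + s • v)‖ ≤ (K + 1) * ((r - r') / (K + 1) * s) := by
          gcongr; linarith
      _ = (r - r') * s := by field_simp
  have h11 := le_abs_self (U (x s) - U (y + s • v))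
  nlinarith

lemma sublevel_compact {U : E2 → ℝ} (hUc : Continuous U) (hUp : ProperFun U) (b : ℝ) :
    IsCompact {y | U y ≤ b} := by
  obtain ⟨R, hR⟩ := hUp (b + 1)
  refine (isCompact_closedBall (0:E2) R).of_isClosed_subset (isClosed_le hUc continuous_const) ?_
  intro y hy
  have hy' : U y ≤ b := hy
  rw [mem_closedBall_zero_iff]
  by_contra! h
  linarith [hR y h.le]

lemma make_band {U G : E2 → ℝ} (hUc : Continuous U) (hUp : ProperFun U) (hU0 : U 0 = 0)
    (hLip : LocallyLipschitzOnSet U (({(0 : E2)} : Set E2)ᶜ))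
    (hGc : Continuous G) (hGp : PosDefFun G) {g : E2 → E2} {Φ : ℝ → E2 → E2} (H : IsFlow g Φ)
    {a b : ℝ} (ha : 0 < a)
    (hd : ∀ y, a ≤ U y → U y ≤ b → dini U (g y) y ≤ ((-(G y) : ℝ) : EReal)) : Band Φ U a b := by
  have hne : ∀ y, a ≤ U y → y ≠ 0 := by
    rintro y hy rfl
    linarith
  have hc : IsCompact {y | a ≤ U y ∧ U y ≤ b} :=
    (sublevel_compact hUc hUp b).of_isClosed_subset
      ((isClosed_le continuous_const hUc).inter (isClosed_le hUc continuous_const)) (fun y hy => hy.2)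
  rcases eq_empty_or_nonempty {y | a ≤ U y ∧ U y ≤ b} with h | h
  · refine ⟨1, one_pos, fun y h1 h2 => ?_⟩
    have : y ∈ {y | a ≤ U y ∧ U y ≤ b} := ⟨h1, h2⟩
    rw [h] at this
    exact absurd this (notMem_empty _)
  · obtain ⟨z, hz, hmin⟩ := hc.exists_isMinOn h hGc.continuousOn
    have hGz : 0 < G z := hGp.2 z (hne z hz.1)
    refine ⟨G z / 2, by positivity, fun y h1 h2 => ?_⟩
    have hGy : G z ≤ G y := hmin (show y ∈ {y | a ≤ U y ∧ U y ≤ b} from ⟨h1, h2⟩)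
    have hder := H.deriv 0 y
    rw [H.zero] at hder
    have := dini_rate hLip (hne y h1) (hd y h1 h2) (fun s => Φ s y) (H.zero y) hder
      (r := -(G z / 2)) (by linarith)
    filter_upwards [this] with s hs
    linarith

/-- Cutoff of a `C¹` vector field with a globally defined flow. -/
lemma exists_cutoff (h : E2 → E2) (hh : ContDiff ℝ 1 h) (r : ℝ) (hr : 0 < r) :
    ∃ g : E2 → E2, ContDiff ℝ 1 g ∧ (∀ y ∈ Metric.ball (0:E2) r, g y = h y) ∧
      ∃ Φ, IsFlow g Φ := by
  let χ : ContDiffBump (0:E2) := ⟨r, r + 1, hr, by linarith⟩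
  have hχ : ContDiff ℝ 1 χ := χ.contDiff
  have hg : ContDiff ℝ 1 (fun y => χ y • h y) := hχ.smul hh
  have hcs : HasCompactSupport (fun y => χ y • h y) := χ.hasCompactSupport.smul_right
  refine ⟨fun y => χ y • h y, hg, ?_, ?_⟩
  · intro y hy
    have : χ y = 1 := χ.one_of_mem_closedBall (Metric.ball_subset_closedBall hy)
    simp [this]
  · obtain ⟨K, hK⟩ := hg.lipschitzWith_of_hasCompactSupport hcs one_ne_zero
    obtain ⟨L, hL⟩ := hcs.exists_bound_of_continuous hg.continuous
    refine exists_flow _ K L.toNNReal hK fun x => ?_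
    exact (hL x).trans (Real.le_coe_toNNReal L)

lemma diverg_congr {f g : E2 → E2} {O : Set E2} (hO : IsOpen O) (hfg : ∀ y ∈ O, g y = f y) {y : E2}
    (hy : y ∈ O) : diverg g y = diverg f y := by
  unfold diverg
  rw [Filter.EventuallyEq.fderiv_eq (Filter.eventually_of_mem (hO.mem_nhds hy) hfg)]

lemma diverg_neg (f : E2 → E2) (y : E2) : diverg (fun x => - f x) y = - diverg f y := by
  unfold diverg
  rw [fderiv_fun_neg]
  simp

/-- Forward uniqueness. -/
lemma flow_unique (h : E2 → E2) (hh : ContDiff ℝ 1 h) {r : ℝ} {g : E2 → E2}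
    (hgh : ∀ y ∈ Metric.ball (0:E2) r, g y = h y) {Φ : ℝ → E2 → E2} (H : IsFlow g Φ)
    {y : E2} (hst : ∀ t, 0 ≤ t → Φ t y ∈ Metric.ball (0:E2) r)
    (x : ℝ → E2) (hx0 : x 0 = y)
    (hx : ∀ t, 0 ≤ t → HasDerivWithinAt x (h (x t)) (Ici 0) t) :
    ∀ t, 0 ≤ t → x t = Φ t y := by
  intro t ht
  have hxc : ContinuousOn x (Icc 0 t) := fun s hs =>
    ((hx s hs.1).continuousWithinAt).mono Icc_subset_Ici_self
  obtain ⟨r1, hr1⟩ := (isCompact_Icc.image_of_continuousOn hxc).isBounded.subset_closedBall 0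
  set ρ := max r r1
  obtain ⟨K, hK⟩ : ∃ K, LipschitzOnWith K h (Metric.closedBall (0:E2) ρ) :=
    hh.locallyLipschitz.locallyLipschitzOn.exists_lipschitzOnWith_of_compact
      (isCompact_closedBall _ _)
  have := ODE_solution_unique_of_mem_Icc_right (v := fun _ => h)
    (s := fun _ => Metric.closedBall (0:E2) ρ) (K := K) (f := x) (g := fun s => Φ s y) (a := 0)
    (b := t) (fun _ _ => hK) hxc
    (fun s hs => (hx s hs.1).mono (Ici_subset_Ici.2 hs.1))
    (fun s hs => Metric.closedBall_subset_closedBall (le_max_right _ _)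
      (hr1 (mem_image_of_mem _ (Ico_subset_Icc_self hs))))
    (H.cont_time y).continuousOn
    (fun s hs => by
      rw [← hgh _ (hst s hs.1)]
      exact (H.deriv s y).hasDerivWithinAt)
    (fun s hs => Metric.closedBall_subset_closedBall (le_max_left _ _)
      (Metric.ball_subset_closedBall (hst s hs.1)))
    (by simp only [hx0, H.zero])
  exact this ⟨ht, le_rfl⟩

lemma enters (g : E2 → E2) (hg : ContDiff ℝ 1 g) (Φ : ℝ → E2 → E2) (H : IsFlow g Φ)
    (Ul Ug : E2 → ℝ) (hUlc : Continuous Ul) (hUgc : Continuous Ug) (hUgp : ProperFun Ug)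
    (hUlpd : PosDefFun Ul) (Mhl Mtg : ℝ) (hMhl : 0 < Mhl)
    (hbl : ∀ a, 0 < a → Band Φ Ul a Mhl) (c : ℝ) (hc : Mtg + 1 ≤ c) (hbg : Band Φ Ug Mtg c)
    (hR : ∀ y ∈ closure ({y : E2 | Ug y ≤ Mtg} \ {y : E2 | Ul y ≤ Mhl}),
      diverg g y ≠ 0 ∧ g y ≠ 0) (r0 : ℝ)
    (hr0 : ∀ y ∈ Metric.closedBall (0:E2) r0, Ug y ≤ c) (y : E2)
    (hy : y ∈ Metric.closedBall (0:E2) r0) : ∃ t, 0 ≤ t ∧ Ul (Φ t y) < Mhl := by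
  set R : Set E2 := closure ({y : E2 | Ug y ≤ Mtg} \ {y : E2 | Ul y ≤ Mhl}) with hRdef
  have hbg1 : Band Φ Ug Mtg (Mtg + 1) := by
    obtain ⟨κ, hκ, hB⟩ := hbg
    exact ⟨κ, hκ, fun y h1 h2 => hB y h1 (h2.trans hc)⟩
  have hRg : ∀ x ∈ R, Ug x ≤ Mtg := fun x hx =>
    closure_minimal (fun z hz => hz.1) (isClosed_le hUgc continuous_const) hx
  have hRl : ∀ x ∈ R, Mhl ≤ Ul x := fun x hx =>
    closure_minimal (t := {z | Mhl ≤ Ul z}) (fun z hz => by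
      have h1 : ¬ Ul z ≤ Mhl := hz.2
      show Mhl ≤ Ul z
      linarith [not_le.1 h1])
      (isClosed_le continuous_const hUlc) hx
  have hRc : IsCompact R :=
    (sublevel_compact hUgc hUgp Mtg).of_isClosed_subset isClosed_closure hRg
  have hstrict : ∀ x, Ul x ≤ Mhl → ∀ t, 0 < t → Ul (Φ t x) < Mhl := fun x hx t ht =>
    band_inv_strict H hUlc (hbl (Mhl/2) (by positivity)) (by linarith) le_rfl hx ht
  have hlow : ∀ x, Ul x < Mhl → ∀ t, 0 ≤ t → Ul (Φ t x) < Mhl := by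
    intro x hx t ht
    rcases eq_or_lt_of_le ht with h | h
    · rw [← h, H.zero]; exact hx
    · exact hstrict x hx.le t h
  have hginv : ∀ x, Ug x ≤ Mtg → ∀ t, 0 ≤ t → Ug (Φ t x) ≤ Mtg := fun x hx t ht =>
    band_inv H hUgc hbg1 le_rfl (by linarith) hx ht
  have hcancel : ∀ t x, Φ t (Φ (-t) x) = x := by
    intro t x
    rw [← H.add, add_neg_cancel, H.zero]
  -- forward lemma
  have hF : ∀ x ∈ Metric.closedBall (0:E2) r0, ∀ T0, 0 ≤ T0 →
      (∀ t, 0 ≤ t → Φ t (Φ T0 x) ∈ R ∧ diverg g (Φ t (Φ T0 x)) ≤ 0) → False := by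
    intro x hx T0 hT0 hxC
    refine no_attractor g hg Φ H R hRc hR {z | Ul z < Mhl} (isOpen_lt hUlc continuous_const)
      (fun z hz t ht => hlow z hz t ht) (fun z hz hz' => absurd (hRl z hz) (not_le.2 hz'))
      {z | Mhl < Ul z} (isOpen_lt continuous_const hUlc) ?_ ?_ {z | Ug z ≤ Mtg}
      (fun z hz t ht => hginv z hz t ht) ?_ ?_ (Metric.closedBall (0:E2) r0)
      (convex_closedBall _ _).isPreconnected ?_ 0 ?_ ?_ x hx T0 hT0 hxC
    · intro z hz
      by_contra! h
      have h1 : Ul z ≤ Mhl := not_lt.1 h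
      exact absurd (hRl _ (hz 1 zero_le_one)) (not_le.2 (hstrict z h1 1 one_pos))
    · intro z hz
      refine ⟨0, le_rfl, ?_⟩
      rw [H.zero]
      have h1 : Ul z < Mhl := hz
      exact not_lt.2 h1.le
    · intro z hz hzO
      refine subset_closure ⟨hz, fun h => ?_⟩
      exact hzO 1 zero_le_one (hstrict z h 1 one_pos)
    · intro z hz
      exact band_nhds H hUgc (by linarith) hbg1 hz
    · intro z hz
      exact band_enter H hUgc (by linarith) hbg (hr0 z hz)
    · have := (norm_nonneg y).trans (mem_closedBall_zero_iff.1 hy)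
      simpa using this
    · simpa [hUlpd.1] using hMhl
  -- backward lemma
  have hB : ∀ x : E2, x ≠ 0 →
      (∀ t, 0 ≤ t → Φ (-t) x ∈ R ∧ 0 ≤ diverg g (Φ (-t) x)) → False := by
    intro x hx hxC
    obtain ⟨ρ, hρ⟩ := hUgp (Mtg + 1)
    have hrank : 1 < Module.rank ℝ E2 := by
      rw [← Module.finrank_eq_rank, finrank_euclideanSpace_fin]
      norm_num
    have hpre : IsPreconnected (({0} : Set E2)ᶜ) :=
      (isConnected_compl_singleton_of_one_lt_rank hrank 0).isPreconnected
    have hx0n : ‖(EuclideanSpace.single 0 (|ρ| + 1) : E2)‖ = |ρ| + 1 := by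
      rw [EuclideanSpace.norm_single, Real.norm_of_nonneg (by positivity)]
    refine no_attractor (fun z => - g z) hg.neg (fun t => Φ (-t)) H.neg R hRc ?_ {z | Mtg < Ug z}
      (isOpen_lt continuous_const hUgc) ?_ (fun z hz hz' => absurd (hRg z hz) (not_le.2 hz'))
      {z | Ug z < Mtg + 1} (isOpen_lt hUgc continuous_const) ?_ ?_ {z | Mhl ≤ Ul z}
      ?_ ?_ ?_ ({0}ᶜ) hpre ?_
      (EuclideanSpace.single 0 (|ρ| + 1)) ?_ ?_ x hx 0 le_rfl ?_
    · intro z hz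
      rw [diverg_neg]
      exact ⟨neg_ne_zero.2 (hR z hz).1, neg_ne_zero.2 (hR z hz).2⟩
    · intro z hz t ht
      by_contra! h
      have h1 : Ug (Φ (-t) z) ≤ Mtg := not_lt.1 h
      have h2 := hginv _ h1 t ht
      rw [hcancel] at h2
      exact absurd h2 (not_le.2 hz)
    · intro z hz
      have h1 := hz 0 le_rfl
      rw [neg_zero, H.zero] at h1
      have := hRg z h1
      show Ug z < Mtg + 1
      linarith
    · intro z hz
      obtain ⟨t, ht, h⟩ := band_back H hUgc (by linarith) hbg1 hz
      exact ⟨t, ht, not_lt.2 h⟩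
    · intro z hz t ht
      by_contra! h
      have h1 : Ul (Φ (-t) z) < Mhl := not_le.1 h
      have h2 := hlow _ h1 t ht
      rw [hcancel] at h2
      exact absurd h2 (not_lt.2 hz)
    · intro z hz hzO
      have hzl : Mhl ≤ Ul z := hz
      have hev : ∀ᶠ n : ℕ in atTop, Φ (-(1 / ((n:ℝ) + 1))) z ∈
          ({y : E2 | Ug y ≤ Mtg} \ {y : E2 | Ul y ≤ Mhl}) := by
        refine Eventually.of_forall fun n => ⟨?_, fun h => ?_⟩
        · have h1 : ¬ Mtg < Ug (Φ (-(1 / ((n:ℝ) + 1))) z) :=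
            hzO (1 / ((n:ℝ) + 1)) (by positivity)
          exact not_lt.1 h1
        have h2 := hstrict _ h (1 / ((n:ℝ) + 1)) (by positivity)
        rw [hcancel] at h2
        linarith
      refine mem_closure_of_tendsto ?_ hev
      have h3 : Tendsto (fun n : ℕ => -(1 / ((n:ℝ) + 1))) atTop (𝓝 0) := by
        simpa using (tendsto_one_div_add_atTop_nhds_zero_nat (𝕜 := ℝ)).neg
      have h4 := ((H.cont_time z).tendsto 0).comp h3
      rwa [H.zero] at h4
    · intro z hz
      have hzl : Mhl ≤ Ul z := hz
      have h1 : Mhl < Ul (Φ (-1) z) := by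
        by_contra! h
        have h2 := hstrict _ h 1 one_pos
        rw [hcancel] at h2
        linarith
      have := (hUlc.comp (H.cont (-1))).continuousAt.eventually (lt_mem_nhds h1)
      filter_upwards [this] with w hw
      exact le_of_lt hw
    · intro z hz
      have hz0 : 0 < Ul z := hUlpd.2 z hz
      rcases le_or_gt Mhl (Ul z) with h | h
      · refine ⟨0, le_rfl, ?_⟩
        rw [neg_zero, H.zero]
        exact h
      · exact band_back H hUlc (by linarith) (hbl (Ul z / 2) (by positivity)) (by linarith)
    · intro h
      have h' : (EuclideanSpace.single 0 (|ρ| + 1) : E2) = 0 := h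
      rw [h', norm_zero] at hx0n
      have := abs_nonneg ρ
      linarith
    · have := hρ (EuclideanSpace.single 0 (|ρ| + 1)) (by rw [hx0n]; linarith [le_abs_self ρ])
      show Mtg < Ug _
      linarith
    · intro t ht
      simp only [neg_zero, H.zero]
      rw [diverg_neg]
      exact ⟨(hxC t ht).1, by linarith [(hxC t ht).2]⟩
  -- the conclusion
  by_contra! hcon
  obtain ⟨T, hT, hTg⟩ := band_enter H hUgc (by linarith) hbg (hr0 y hy)
  have hyR : ∀ t, T ≤ t → Φ t y ∈ R := by
    intro t ht
    refine subset_closure ⟨?_, fun h => ?_⟩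
    · have := hginv _ hTg (t - T) (by linarith)
      rwa [← H.add, sub_add_cancel] at this
    · have h1 := hstrict _ h 1 one_pos
      rw [← H.add] at h1
      linarith [hcon (1 + t) (by linarith)]
  have hpos : ∀ t, T ≤ t → 0 < diverg g (Φ t y) := by
    obtain ⟨s, hs, hsp⟩ : ∃ s, T ≤ s ∧ 0 < diverg g (Φ s y) := by
      by_contra! hneg
      refine hF y hy T hT fun t ht => ?_
      rw [← H.add]
      exact ⟨hyR _ (by linarith), hneg _ (by linarith)⟩
    exact sign_const hg H (fun t ht => (hR _ (hyR t ht)).1) hs hsp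
  obtain ⟨w, hw, φ, hφ, hlim⟩ := hRc.tendsto_subseq (x := fun n : ℕ => Φ (T + n) y)
    (fun n => hyR _ (by simp))
  have hwall : ∀ t : ℝ, Φ t w ∈ R ∩ {z | 0 ≤ diverg g z} := by
    intro t
    have hcl : IsClosed (R ∩ {z | 0 ≤ diverg g z}) :=
      isClosed_closure.inter (isClosed_le continuous_const (diverg_cont g hg))
    refine hcl.mem_of_tendsto (((H.cont t).tendsto w).comp hlim) ?_
    have h1 : Tendsto (fun n => ((φ n : ℕ) : ℝ)) atTop atTop :=
      tendsto_natCast_atTop_atTop.comp hφ.tendsto_atTop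
    filter_upwards [h1.eventually_ge_atTop (-t)] with n hn
    simp only [Function.comp]
    rw [← H.add]
    exact ⟨hyR _ (by linarith), (hpos _ (by linarith)).le⟩
  refine hB w ?_ fun t _ => hwall (-t)
  rintro rfl
  have := hRl _ hw
  rw [hUlpd.1] at this
  linarith

lemma small_sublevel {U : E2 → ℝ} (hUc : Continuous U) (hUp : ProperFun U) (hUpd : PosDefFun U)
    {M : ℝ} (hM : 0 < M) {ε : ℝ} (hε : 0 < ε) :
    ∃ a, 0 < a ∧ a ≤ M ∧ ∀ y, U y ≤ a → ‖y‖ < ε := by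
  have hc : IsCompact {y : E2 | U y ≤ M ∧ ε ≤ ‖y‖} :=
    (sublevel_compact hUc hUp M).of_isClosed_subset
      ((isClosed_le hUc continuous_const).inter (isClosed_le continuous_const continuous_norm))
      (fun y hy => hy.1)
  rcases eq_empty_or_nonempty {y : E2 | U y ≤ M ∧ ε ≤ ‖y‖} with h | h
  · refine ⟨M, hM, le_rfl, fun y hy => ?_⟩
    by_contra! hcon
    have : y ∈ {y : E2 | U y ≤ M ∧ ε ≤ ‖y‖} := ⟨hy, hcon⟩
    rw [h] at this
    exact notMem_empty _ this
  · obtain ⟨z, hz, hmin⟩ := hc.exists_isMinOn h hUc.continuousOn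
    have hz0 : 0 < U z := hUpd.2 z (norm_pos_iff.1 (hε.trans_le hz.2))
    refine ⟨min M (U z / 2), lt_min hM (by positivity), min_le_left _ _, fun y hy => ?_⟩
    by_contra! hcon
    have h1 : U z ≤ U y :=
      hmin (show y ∈ {y : E2 | U y ≤ M ∧ ε ≤ ‖y‖} from ⟨hy.trans (min_le_left _ _), hcon⟩)
    have h2 := hy.trans (min_le_right _ _)
    linarith

/-- **Theorem 2** (global asymptotic stability in the plane). -/
theorem theorem2_global_asymptotic_stability_planar
    (h : EuclideanSpace ℝ (Fin 2) → EuclideanSpace ℝ (Fin 2)) (hh : ContDiff ℝ 1 h)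
    -- forward flow of ẏ = h(y)
    (Y : ℝ → EuclideanSpace ℝ (Fin 2) → EuclideanSpace ℝ (Fin 2))
    (hY0 : ∀ y, Y 0 y = y)
    (hYd : ∀ (y : EuclideanSpace ℝ (Fin 2)) (t : ℝ), 0 ≤ t →
      HasDerivWithinAt (fun s => Y s y) (h (Y t y)) (Set.Ici 0) t)
    -- Lyapunov-like data
    (Ul Ug : EuclideanSpace ℝ (Fin 2) → ℝ)
    (hUlc : Continuous Ul) (hUlp : ProperFun Ul) (hUlpd : PosDefFun Ul)
    (hUlnn : ∀ y, 0 ≤ Ul y)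
    (hUlLip : LocallyLipschitzOnSet Ul
      (({(0 : EuclideanSpace ℝ (Fin 2))} : Set (EuclideanSpace ℝ (Fin 2)))ᶜ))
    (hUgc : Continuous Ug) (hUgp : ProperFun Ug) (hUgpd : PosDefFun Ug)
    (hUgnn : ∀ y, 0 ≤ Ug y)
    (hUgLip : LocallyLipschitzOnSet Ug
      (({(0 : EuclideanSpace ℝ (Fin 2))} : Set (EuclideanSpace ℝ (Fin 2)))ᶜ))
    (El Eg : EuclideanSpace ℝ (Fin 2) → ℝ)
    (hElc : Continuous El) (hElpd : PosDefFun El) (hElnn : ∀ y, 0 ≤ El y)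
    (hEgc : Continuous Eg) (hEgpd : PosDefFun Eg) (hEgnn : ∀ y, 0 ≤ Eg y)
    (Mhl Mtg : ℝ) (hMhl : 0 < Mhl) (hMtg : 0 < Mtg)
    -- (i)
    (hi : ∀ y : EuclideanSpace ℝ (Fin 2), y ≠ 0 → Ul y ≤ Mhl →
      dini Ul (h y) y ≤ ((-(El y) : ℝ) : EReal))
    -- (ii)
    (hii : ∀ y : EuclideanSpace ℝ (Fin 2), Mtg ≤ Ug y →
      dini Ug (h y) y ≤ ((-(Eg y) : ℝ) : EReal))
    -- (iii)
    (hiii : {y : EuclideanSpace ℝ (Fin 2) | Ul y ≤ Mhl} ⊂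
            {y : EuclideanSpace ℝ (Fin 2) | Ug y ≤ Mtg})
    -- on R, div h ≠ 0 and h ≠ 0
    (hR : ∀ y ∈ closure ({y : EuclideanSpace ℝ (Fin 2) | Ug y ≤ Mtg} \
        {y : EuclideanSpace ℝ (Fin 2) | Ul y ≤ Mhl}),
      diverg h y ≠ 0 ∧ h y ≠ 0) :
    -- Lyapunov stability of the origin
    (∀ ε : ℝ, 0 < ε → ∃ δ : ℝ, 0 < δ ∧
      ∀ y : EuclideanSpace ℝ (Fin 2), ‖y‖ < δ → ∀ t : ℝ, 0 ≤ t → ‖Y t y‖ < ε) ∧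
    -- global attractivity of the origin
    ∀ y : EuclideanSpace ℝ (Fin 2),
      Filter.Tendsto (fun t : ℝ => Y t y) Filter.atTop
        (𝓝 (0 : EuclideanSpace ℝ (Fin 2))) := by
  have key : ∀ r0 : ℝ, 0 ≤ r0 → ∃ g Φ, IsFlow g Φ ∧ (∀ a, 0 < a → Band Φ Ul a Mhl) ∧
      (∀ y ∈ Metric.closedBall (0:E2) r0, ∃ t, 0 ≤ t ∧ Ul (Φ t y) < Mhl) ∧
      (∀ y ∈ Metric.closedBall (0:E2) r0, ∀ t, 0 ≤ t → Y t y = Φ t y) := by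
    intro r0 hr0
    obtain ⟨ym, hym, hmax⟩ := (isCompact_closedBall (0:E2) r0).exists_isMaxOn
      ⟨0, by simpa using hr0⟩ hUgc.continuousOn
    obtain ⟨c, hc1, hc2⟩ : ∃ c, Mtg + 1 ≤ c ∧ Ug ym ≤ c :=
      ⟨max (Mtg + 1) (Ug ym), le_max_left _ _, le_max_right _ _⟩
    have hXc : ∀ y ∈ Metric.closedBall (0:E2) r0, Ug y ≤ c := fun y hy =>
      le_trans (hmax hy) hc2
    obtain ⟨ρ, hρ⟩ := hUgp (c + 1)
    have hball : ∀ y, Ug y ≤ c → y ∈ Metric.ball (0:E2) (max ρ 1) := by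
      intro y hy
      rw [mem_ball_zero_iff]
      by_contra! h
      linarith [hρ y ((le_max_left _ _).trans h)]
    obtain ⟨g, hg, hgh, Φ, H⟩ := exists_cutoff h hh (max ρ 1) (by positivity)
    have hbl : ∀ a, 0 < a → Band Φ Ul a Mhl := by
      intro a ha
      refine make_band hUlc hUlp hUlpd.1 hUlLip hElc hElpd H ha fun y h1 h2 => ?_
      have hy0 : y ≠ 0 := by
        rintro rfl
        rw [hUlpd.1] at h1
        linarith
      have h3 : Ug y ≤ Mtg := hiii.1 h2
      rw [hgh y (hball y (by linarith))]
      exact hi y hy0 h2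
    have hbg : Band Φ Ug Mtg c := by
      refine make_band hUgc hUgp hUgpd.1 hUgLip hEgc hEgpd H hMtg fun y h1 h2 => ?_
      rw [hgh y (hball y h2)]
      exact hii y h1
    refine ⟨g, Φ, H, hbl, ?_, ?_⟩
    · refine enters g hg Φ H Ul Ug hUlc hUgc hUgp hUlpd Mhl Mtg hMhl hbl c hc1 hbg ?_ r0 hXc
      intro y hy
      have h1 : Ug y ≤ Mtg :=
        closure_minimal (fun z hz => hz.1) (isClosed_le hUgc continuous_const) hy
      have h2 := hball y (by linarith)
      rw [diverg_congr Metric.isOpen_ball hgh h2, hgh y h2]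
      exact hR y hy
    · intro y hy
      refine flow_unique h hh hgh H (fun t ht => hball _ ?_) (fun s => Y s y) (hY0 y) (hYd y)
      exact band_inv H hUgc hbg (by linarith) le_rfl (hXc y hy) ht
  constructor
  · intro ε hε
    obtain ⟨g, Φ, H, hbl, -, hY⟩ := key 1 zero_le_one
    obtain ⟨a, ha, haM, hsm⟩ := small_sublevel hUlc hUlp hUlpd hMhl hε
    have h0 : ∀ᶠ y in 𝓝 (0:E2), Ul y < a :=
      hUlc.continuousAt.eventually (gt_mem_nhds (by rw [hUlpd.1]; exact ha))
    obtain ⟨δ, hδ, hδ'⟩ := Metric.eventually_nhds_iff.1 h0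
    refine ⟨min δ 1, lt_min hδ one_pos, fun y hy t ht => ?_⟩
    have h1 : Ul y < a := hδ' (by rw [dist_zero_right]; exact hy.trans_le (min_le_left _ _))
    rw [hY y (by rw [mem_closedBall_zero_iff]; exact (hy.trans_le (min_le_right _ _)).le) t ht]
    exact hsm _ (band_inv H hUlc (hbl a ha) le_rfl haM h1.le ht)
  · intro y
    obtain ⟨g, Φ, H, hbl, hent, hY⟩ := key ‖y‖ (norm_nonneg y)
    have hyb : y ∈ Metric.closedBall (0:E2) ‖y‖ := by simp
    obtain ⟨T, hT, hTl⟩ := hent y hyb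
    rw [Metric.tendsto_atTop]
    intro ε hε
    obtain ⟨a, ha, haM, hsm⟩ := small_sublevel hUlc hUlp hUlpd hMhl hε
    obtain ⟨S, hS, hSl⟩ := band_enter H hUlc haM (hbl a ha) hTl.le
    refine ⟨S + T, fun t ht => ?_⟩
    rw [hY y hyb t (by linarith), dist_zero_right]
    apply hsm
    have := band_inv H hUlc (hbl a ha) le_rfl haM hSl (t := t - (S + T)) (by linarith)
    rwa [← H.add, ← H.add, show t - (S + T) + S + T = t by ring] at this
end
end

section
/- Claim 1 (nested sublevel sets). Let V : ℝ^n → [0,∞) and W : ℝ^m → [0,∞) be continuous, proper, positive definite functions, let γ, δ be class K∞ functions, and let σ be a class K∞ function satisfying δ(s) < σ(s) < γ⁻¹(s) for all s > 0. Let constants 0 ≤ M̲ < M̄ < ∞ and 0 ≤ N̲ < N̄ < ∞ satisfy M̃ := max{γ⁻¹(M̲), N̲} < min{δ(M̄), N̄} =: M̂, and define U(x,z) := max{σ(V(x)), W(z)}. Then: (a) there exists c > 0 such that Ω_{≤c}(U) ⊆ Ω_{≤M̄}(V) × Ω_{≤N̄}(W); and (b) Ω_{≤M̲}(V) × Ω_{≤N̲}(W)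 ⊆ Ω_{≤M̃}(U) ⊆ Ω_{≤M̂}(U) ⊆ Ω_{≤M̄}(V) × Ω_{≤N̄}(W). -/
open Filter Topology Set

noncomputable section

/-- **Claim 1** (nested sublevel sets). -/
theorem claim1_nested_sublevel_sets
    (n m : ℕ) (hn : 1 ≤ n) (hm : 1 ≤ m)
    (V : EuclideanSpace ℝ (Fin n) → ℝ) (W : EuclideanSpace ℝ (Fin m) → ℝ)
    (hVc : Continuous V) (hVp : ProperFun V) (hVpd : PosDefFun V) (hVnn : ∀ x, 0 ≤ V x)
    (hWc : Continuous W) (hWp : ProperFun W) (hWpd : PosDefFun W) (hWnn : ∀ z, 0 ≤ W z)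
    (γ δ γinv σ : ℝ → ℝ) (hγ : ClassKInf γ) (hδ : ClassKInf δ)
    (hγinv₁ : ∀ s, 0 ≤ s → γinv (γ s) = s) (hγinv₂ : ∀ s, 0 ≤ s → γ (γinv s) = s)
    (hσ : ClassKInf σ)
    (hsand : ∀ s : ℝ, 0 < s → δ s < σ s ∧ σ s < γinv s)
    (Ml Mu Nl Nu : ℝ)
    (hMl : 0 ≤ Ml) (hMlu : Ml < Mu) (hNl : 0 ≤ Nl) (hNlu : Nl < Nu)
    (hMM : max (γinv Ml) Nl < min (δ Mu) Nu)
    (U : EuclideanSpace ℝ (Fin n) × EuclideanSpace ℝ (Fin m) → ℝ)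
    (hUdef : ∀ p : EuclideanSpace ℝ (Fin n) × EuclideanSpace ℝ (Fin m),
      U p = max (σ (V p.1)) (W p.2)) :
    -- (a)
    (∃ c : ℝ, 0 < c ∧
      {p : EuclideanSpace ℝ (Fin n) × EuclideanSpace ℝ (Fin m) | U p ≤ c} ⊆
        ({x | V x ≤ Mu} : Set (EuclideanSpace ℝ (Fin n))) ×ˢ
        ({z | W z ≤ Nu} : Set (EuclideanSpace ℝ (Fin m)))) ∧
    -- (b)
    (({x | V x ≤ Ml} : Set (EuclideanSpace ℝ (Fin n))) ×ˢ
        ({z | W z ≤ Nl} : Set (EuclideanSpace ℝ (Fin m))) ⊆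
      {p : EuclideanSpace ℝ (Fin n) × EuclideanSpace ℝ (Fin m) | U p ≤ max (γinv Ml) Nl}) ∧
    ({p : EuclideanSpace ℝ (Fin n) × EuclideanSpace ℝ (Fin m) | U p ≤ max (γinv Ml) Nl} ⊆
      {p : EuclideanSpace ℝ (Fin n) × EuclideanSpace ℝ (Fin m) | U p ≤ min (δ Mu) Nu}) ∧
    ({p : EuclideanSpace ℝ (Fin n) × EuclideanSpace ℝ (Fin m) | U p ≤ min (δ Mu) Nu} ⊆
      ({x | V x ≤ Mu} : Set (EuclideanSpace ℝ (Fin n))) ×ˢ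
        ({z | W z ≤ Nu} : Set (EuclideanSpace ℝ (Fin m)))) := by
  obtain ⟨_, hσm, hσ0, _⟩ := hσ
  have hMu : 0 < Mu := lt_of_le_of_lt hMl hMlu
  have hlast : {p : EuclideanSpace ℝ (Fin n) × EuclideanSpace ℝ (Fin m) |
      U p ≤ min (δ Mu) Nu} ⊆
      ({x | V x ≤ Mu} : Set (EuclideanSpace ℝ (Fin n))) ×ˢ
        ({z | W z ≤ Nu} : Set (EuclideanSpace ℝ (Fin m))) := by
    intro p hp
    rw [Set.mem_setOf_eq, hUdef] at hp
    have h1 : σ (V p.1) ≤ δ Mu := (le_max_left _ _).trans (hp.trans (min_le_left _ _))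
    have h2 : W p.2 ≤ Nu := (le_max_right _ _).trans (hp.trans (min_le_right _ _))
    refine ⟨?_, h2⟩
    have h3 : σ (V p.1) ≤ σ Mu := h1.trans (hsand Mu hMu).1.le
    exact (hσm.le_iff_le (Set.mem_Ici.2 (hVnn p.1)) (Set.mem_Ici.2 hMu.le)).1 h3
  have hσγ : σ Ml ≤ γinv Ml := by
    rcases hMl.eq_or_lt with h | h
    · subst h
      have h0 := hγinv₁ 0 le_rfl
      rw [hγ.2.2.1] at h0
      rw [hσ0, h0]
    · exact (hsand Ml h).2.le
  refine ⟨⟨min (δ Mu) Nu, lt_of_le_of_lt (hNl.trans (le_max_right _ _)) hMM, hlast⟩,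
    ?_, fun p hp => le_trans hp hMM.le, hlast⟩
  rintro p ⟨h1, h2⟩
  rw [Set.mem_setOf_eq, hUdef]
  refine max_le_max ?_ h2
  exact ((hσm.le_iff_le (Set.mem_Ici.2 (hVnn p.1)) (Set.mem_Ici.2 hMl)).2 h1).trans hσγ
end
end

section
/- Decrease of the composite Lyapunov function (second part of the proof of Proposition 1). Let V be a storage function on ℝ^n and W a storage function on ℝ^m, let f ∈ C¹(ℝ^n × ℝ^m, ℝ^n), g ∈ C¹(ℝ^n × ℝ^m, ℝ^m), and suppose Assumption 1 holds with class K∞ gains γ, δ, continuous positive definite proper λ_x, λ_z, and constants 0 ≤ M̲ < M̄ < ∞, 0 ≤ N̲ < N̄ < ∞. Let σ be a class K∞ function, continuously differentiable on [0,∞) with σ'(s) > 0 for s > 0, satisfying δ(s) < σ(s) < γ⁻¹(s) for all s > 0, and define U(x,z) := max{σ(V(x)), W(z)}. Then for every (x,z) ∈ S with (x,z) ≠ (0,0), D⁺_{f,g} U(x,z) ≤ −min{σ'(V(x))·λ_x(x), λ_z(z)}. -/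
open Filter Topology Set

noncomputable section

/-- A real upper bound on the Dini derivative bounds the difference quotients eventually. -/
theorem dini_eventually {E : Type*} [NormedAddCommGroup E] [NormedSpace ℝ E]
    {U : E → ℝ} {v y : E} {r r' : ℝ} (h : dini U v y ≤ (r : EReal)) (hr : r < r') :
    ∀ᶠ τ in 𝓝[>] (0:ℝ), (U (y + τ • v) - U y) / τ < r' := by
  have h1 : dini U v y < (r' : EReal) := lt_of_le_of_lt h (EReal.coe_lt_coe_iff.2 hr)
  have h2 := Filter.eventually_lt_of_limsup_lt h1
  filter_upwards [h2] with τ hτ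
  exact EReal.coe_lt_coe_iff.1 hτ

/-- Eventual bounds on the difference quotients bound the Dini derivative. -/
theorem dini_le_of_eventually {E : Type*} [NormedAddCommGroup E] [NormedSpace ℝ E]
    {U : E → ℝ} {v y : E} {r : ℝ}
    (h : ∀ r', r < r' → ∀ᶠ τ in 𝓝[>] (0:ℝ), (U (y + τ • v) - U y) / τ < r') :
    dini U v y ≤ (r : EReal) := by
  refine EReal.le_of_forall_lt_iff_le.1 fun r' hr' => ?_
  refine Filter.limsup_le_of_le (by isBoundedDefault) ?_
  filter_upwards [h r' (EReal.coe_lt_coe_iff.1 hr')] with τ hτ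
  exact EReal.coe_le_coe_iff.2 hτ.le

/-- The ray `y + τ v` converges to `y` as `τ → 0⁺`. -/
theorem tendsto_ray {E : Type*} [NormedAddCommGroup E] [NormedSpace ℝ E] (v y : E) :
    Tendsto (fun τ : ℝ => y + τ • v) (𝓝[>] (0:ℝ)) (𝓝 y) := by
  have h : Continuous (fun τ : ℝ => y + τ • v) := by fun_prop
  have h2 := h.tendsto 0
  simp only [zero_smul, add_zero] at h2
  exact h2.mono_left nhdsWithin_le_nhds

/-- Chain rule for Dini derivatives with an increasing differentiable outer function. -/
theorem chain_eventually {E : Type*} [NormedAddCommGroup E] [NormedSpace ℝ E]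
    {V : E → ℝ} (hVc : Continuous V) {v y : E} {L c : ℝ} {σ : ℝ → ℝ}
    (hσ : HasDerivAt σ c (V y)) (hc : 0 < c)
    (h : dini V v y ≤ ((-L : ℝ) : EReal)) {r : ℝ} (hr : -(c * L) < r) :
    ∀ᶠ τ in 𝓝[>] (0:ℝ), (σ (V (y + τ • v)) - σ (V y)) / τ < r := by
  obtain ⟨r₁, hr₁, hr₂⟩ : ∃ r₁, -L < r₁ ∧ c * r₁ < r := by
    obtain ⟨q, hq1, hq2⟩ := exists_between hr
    refine ⟨q / c, ?_, ?_⟩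
    · rw [lt_div_iff₀ hc]; linarith
    · rw [mul_div_cancel₀ _ hc.ne']; exact hq2
  have hds : ContinuousAt (dslope σ (V y)) (V y) :=
    continuousAt_dslope_same.2 hσ.differentiableAt
  have hs : Tendsto (fun τ : ℝ => dslope σ (V y) (V (y + τ • v))) (𝓝[>] (0:ℝ)) (𝓝 c) := by
    have h1 : Tendsto (fun τ : ℝ => V (y + τ • v)) (𝓝[>] (0:ℝ)) (𝓝 (V y)) :=
      (hVc.tendsto y).comp (tendsto_ray v y)
    have h2 := hds.tendsto.comp h1
    rw [dslope_same, hσ.deriv] at h2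
    exact h2
  have e1 := hs.eventually (lt_mem_nhds hc)
  have e2 := (hs.mul_const r₁).eventually (gt_mem_nhds hr₂)
  filter_upwards [e1, e2, dini_eventually h hr₁] with τ h1 h2 h3
  have h4 := sub_smul_dslope σ (V y) (V (y + τ • v))
  rw [smul_eq_mul] at h4
  rw [← h4, mul_comm, mul_div_assoc]
  exact lt_of_le_of_lt (mul_le_mul_of_nonneg_left h3.le h1.le) h2

/-- A storage function vanishes only at the origin. -/
theorem IsStorage.eq_zero {E : Type*} [NormedAddCommGroup E] {V : E → ℝ}
    (hV : IsStorage V) {x : E} (h : V x = 0) : x = 0 := by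
  obtain ⟨_, _, a, b, ha, _, hab⟩ := hV
  by_contra hx
  have h1 : a 0 < a ‖x‖ := ha.2.1 (Set.mem_Ici.2 le_rfl) (Set.mem_Ici.2 (norm_nonneg x))
    (norm_pos_iff.2 hx)
  rw [ha.2.2.1] at h1
  linarith [(hab x).1]

/-- **Decrease of the composite Lyapunov function**
(second part of the proof of Proposition 1). -/
theorem composite_lyapunov_decrease
    (n m : ℕ) (hn : 1 ≤ n) (hm : 1 ≤ m)
    (V : EuclideanSpace ℝ (Fin n) → ℝ) (W : EuclideanSpace ℝ (Fin m) → ℝ)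
    (hV : IsStorage V) (hW : IsStorage W)
    (f : EuclideanSpace ℝ (Fin n) × EuclideanSpace ℝ (Fin m) → EuclideanSpace ℝ (Fin n))
    (g : EuclideanSpace ℝ (Fin n) × EuclideanSpace ℝ (Fin m) → EuclideanSpace ℝ (Fin m))
    (hf : ContDiff ℝ 1 f) (hg : ContDiff ℝ 1 g)
    (γ δ γinv : ℝ → ℝ) (hγ : ClassKInf γ) (hδ : ClassKInf δ)
    (hγinv₁ : ∀ s, 0 ≤ s → γinv (γ s) = s) (hγinv₂ : ∀ s, 0 ≤ s → γ (γinv s) = s)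
    (lamx : EuclideanSpace ℝ (Fin n) → ℝ) (lamz : EuclideanSpace ℝ (Fin m) → ℝ)
    (hlamx : Continuous lamx ∧ PosDefFun lamx ∧ ProperFun lamx)
    (hlamz : Continuous lamz ∧ PosDefFun lamz ∧ ProperFun lamz)
    (Ml Mu Nl Nu : ℝ)
    (hMl : 0 ≤ Ml) (hMlu : Ml < Mu) (hNl : 0 ≤ Nl) (hNlu : Nl < Nu)
    -- Assumption 1 on the region `S`
    (hA1 : ∀ p : EuclideanSpace ℝ (Fin n) × EuclideanSpace ℝ (Fin m),
      p ∈ ({p | Ml ≤ V p.1 ∧ V p.1 ≤ Mu ∧ W p.2 ≤ Nu} ∪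
            {p | V p.1 ≤ Mu ∧ Nl ≤ W p.2 ∧ W p.2 ≤ Nu} :
              Set (EuclideanSpace ℝ (Fin n) × EuclideanSpace ℝ (Fin m))) →
        (γ (W p.2) ≤ V p.1 → dini V (f p) p.1 ≤ ((-(lamx p.1) : ℝ) : EReal)) ∧
        (δ (V p.1) ≤ W p.2 → dini W (g p) p.2 ≤ ((-(lamz p.2) : ℝ) : EReal)))
    -- σ is of class K∞, continuously differentiable on [0,∞) with σ' > 0 on (0,∞)
    (σ σ' : ℝ → ℝ) (hσ : ClassKInf σ)
    (hσd : ∀ s : ℝ, 0 ≤ s → HasDerivWithinAt σ (σ' s) (Set.Ici 0) s)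
    (hσ'c : ContinuousOn σ' (Set.Ici 0)) (hσ'pos : ∀ s : ℝ, 0 < s → 0 < σ' s)
    -- δ(s) < σ(s) < γ⁻¹(s) for all s > 0
    (hsand : ∀ s : ℝ, 0 < s → δ s < σ s ∧ σ s < γinv s)
    -- the composite function U
    (U : EuclideanSpace ℝ (Fin n) × EuclideanSpace ℝ (Fin m) → ℝ)
    (hUdef : ∀ p : EuclideanSpace ℝ (Fin n) × EuclideanSpace ℝ (Fin m),
      U p = max (σ (V p.1)) (W p.2)) :
    ∀ p : EuclideanSpace ℝ (Fin n) × EuclideanSpace ℝ (Fin m),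
      p ∈ ({p | Ml ≤ V p.1 ∧ V p.1 ≤ Mu ∧ W p.2 ≤ Nu} ∪
            {p | V p.1 ≤ Mu ∧ Nl ≤ W p.2 ∧ W p.2 ≤ Nu} :
              Set (EuclideanSpace ℝ (Fin n) × EuclideanSpace ℝ (Fin m))) →
      p ≠ 0 →
      dini U (f p, g p) p ≤
        ((-(min (σ' (V p.1) * lamx p.1) (lamz p.2)) : ℝ) : EReal) := by
  rintro ⟨x, z⟩ hp hp0
  have hV0 : 0 ≤ V x := hV.1 x
  have hW0 : 0 ≤ W z := hW.1 z
  have hVc : Continuous V := hV.2.1.continuous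
  have hWc : Continuous W := hW.2.1.continuous
  obtain ⟨hA, hB⟩ := hA1 _ hp
  dsimp only at hA hB ⊢
  set F := f (x, z)
  set G := g (x, z)
  have hσV : Continuous (fun x => σ (V x)) :=
    hσ.1.comp_continuous hVc (fun x => hV.1 x)
  have tV : Tendsto (fun τ : ℝ => σ (V (x + τ • F))) (𝓝[>] (0:ℝ)) (𝓝 (σ (V x))) :=
    (hσV.tendsto x).comp (tendsto_ray F x)
  have tW : Tendsto (fun τ : ℝ => W (z + τ • G)) (𝓝[>] (0:ℝ)) (𝓝 (W z)) :=
    (hWc.tendsto z).comp (tendsto_ray G z)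
  have hσ0 : ∀ s, 0 ≤ s → 0 ≤ σ s := fun s hs => by
    have := hσ.2.1.monotoneOn (Set.mem_Ici.2 le_rfl) (Set.mem_Ici.2 hs) hs
    rwa [hσ.2.2.1] at this
  have hX : 0 < V x → W z ≤ σ (V x) → ∀ r, -(σ' (V x) * lamx x) < r →
      ∀ᶠ τ in 𝓝[>] (0:ℝ), (σ (V (x + τ • F)) - σ (V x)) / τ < r := by
    intro hpos hle r hr
    have hlt : W z < γinv (V x) := lt_of_le_of_lt hle (hsand _ hpos).2
    have h1 : γ (W z) < γ (γinv (V x)) :=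
      hγ.2.1 (Set.mem_Ici.2 hW0) (Set.mem_Ici.2 (hW0.trans hlt.le)) hlt
    rw [hγinv₂ _ hV0] at h1
    exact chain_eventually hVc ((hσd _ hV0).hasDerivAt (Ici_mem_nhds hpos))
      (hσ'pos _ hpos) (hA h1.le) hr
  have hZ : σ (V x) ≤ W z → ∀ r, -(lamz z) < r →
      ∀ᶠ τ in 𝓝[>] (0:ℝ), (W (z + τ • G) - W z) / τ < r := by
    intro hle r hr
    refine dini_eventually (hB ?_) hr
    rcases hV0.eq_or_lt with h0 | h0
    · rw [← h0, hδ.2.2.1]; exact hW0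
    · exact (hsand _ h0).1.le.trans hle
  refine dini_le_of_eventually fun r hr => ?_
  have hr1 : -(σ' (V x) * lamx x) < r :=
    lt_of_le_of_lt (neg_le_neg (min_le_left _ _)) hr
  have hr2 : -(lamz z) < r := lt_of_le_of_lt (neg_le_neg (min_le_right _ _)) hr
  simp only [hUdef, Prod.fst_add, Prod.snd_add, Prod.smul_fst, Prod.smul_snd]
  rcases lt_trichotomy (σ (V x)) (W z) with hlt | heq | hgt
  · filter_upwards [hZ hlt.le r hr2, tV.eventually_lt tW hlt] with τ h1 h2
    rw [max_eq_right hlt.le, max_eq_right h2.le]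
    exact h1
  · have hpos : 0 < V x := by
      rcases hV0.eq_or_lt with h0 | h0
      · exfalso
        apply hp0
        have hw : W z = 0 := by rw [← heq, ← h0, hσ.2.2.1]
        rw [hV.eq_zero h0.symm, hW.eq_zero hw]
        rfl
      · exact h0
    filter_upwards [hZ heq.le r hr2, hX hpos heq.ge r hr1] with τ h1 h2
    rcases max_cases (σ (V (x + τ • F))) (W (z + τ • G)) with h | h
    · rw [h.1, max_eq_left heq.ge]; exact h2
    · rw [h.1, max_eq_right heq.le]; exact h1
  · have hpos : 0 < V x := by
      rcases hV0.eq_or_lt with h0 | h0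
      · exfalso
        rw [← h0, hσ.2.2.1] at hgt
        linarith
      · exact h0
    filter_upwards [hX hpos hgt.le r hr1, tW.eventually_lt tV hgt] with τ h1 h2
    rw [max_eq_left hgt.le, max_eq_left h2.le]
    exact h1
end
end

section
/- Convergence from a Dini-derivative decrease condition along a curve (third part of the proof of Proposition 1). Let k ≥ 1, let U : ℝ^k → [0,∞) be continuous, positive definite and proper, let E : ℝ^k → [0,∞) be continuous and positive definite, and let 0 ≤ M̃ < M̂ be constants. Let Y : [0,∞) → ℝ^k be continuous and suppose that for every t ≥ 0 with M̃ ≤ U(Y(t)) ≤ M̂ one has D⁺(U∘Y)(t) := limsup_{τ→0⁺} (U(Y(t+τ)) − U(Y(t)))/τ ≤ −E(Y(t)). If U(Y(0)) ≤ M̂, then U(Y(t)) ≤ M̂ for all t ≥ 0 and limsup_{t→∞} U(Y(t)) ≤ M̃. -/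
open Filter Topology Set

noncomputable section

theorem fence_aux {f B : ℝ → ℝ} {b : ℝ}
    (hf : ContinuousOn f (Icc 0 b)) (hB : ContinuousOn B (Icc 0 b)) (ha : f 0 ≤ B 0)
    (h : ∀ x ∈ Ico 0 b, f x = B x → ∀ᶠ z in 𝓝[>] x, f z ≤ B z) :
    ∀ x ∈ Icc 0 b, f x ≤ B x := by
  change Icc 0 b ⊆ { x | f x ≤ B x }
  set s := { x | f x ≤ B x } ∩ Icc 0 b with hs
  have A : ContinuousOn (fun x => (f x, B x)) (Icc 0 b) := hf.prodMk hB
  have hcl : IsClosed s := by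
    simp only [hs, inter_comm]
    exact A.preimage_isClosed_of_isClosed isClosed_Icc OrderClosedTopology.isClosed_le'
  refine hcl.Icc_subset_of_forall_exists_gt ha ?_
  rintro x ⟨hxB : f x ≤ B x, hx⟩ y hy
  have hev : ∀ᶠ z in 𝓝[>] x, f z ≤ B z := by
    rcases hxB.lt_or_eq with hlt | heq
    · have h1 : ∀ᶠ z in 𝓝[Icc 0 b] x, f z < B z :=
        A x (Ico_subset_Icc_self hx) (IsOpen.mem_nhds (isOpen_lt continuous_fst continuous_snd) hlt)
      have h2 : ∀ᶠ z in 𝓝[>] x, f z < B z :=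
        nhdsWithin_le_of_mem (Icc_mem_nhdsGT_of_mem hx) h1
      exact h2.mono fun z hz => hz.le
    · exact h x hx heq
  obtain ⟨z, hz1, hz2⟩ := (hev.and (Ioc_mem_nhdsGT hy)).exists
  exact ⟨z, hz1, hz2⟩

/-- **Convergence from a Dini-derivative decrease condition along a curve**
(third part of the proof of Proposition 1). -/
theorem convergence_from_dini_decrease_along_curve
    (k : ℕ) (hk : 1 ≤ k)
    (U : EuclideanSpace ℝ (Fin k) → ℝ)
    (hUc : Continuous U) (hUpd : PosDefFun U) (hUp : ProperFun U) (hUnn : ∀ y, 0 ≤ U y)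
    (E : EuclideanSpace ℝ (Fin k) → ℝ)
    (hEc : Continuous E) (hEpd : PosDefFun E) (hEnn : ∀ y, 0 ≤ E y)
    (Mt Mh : ℝ) (hMt : 0 ≤ Mt) (hMth : Mt < Mh)
    (Y : ℝ → EuclideanSpace ℝ (Fin k)) (hYc : ContinuousOn Y (Set.Ici 0))
    (hdec : ∀ t : ℝ, 0 ≤ t → Mt ≤ U (Y t) → U (Y t) ≤ Mh →
      Filter.limsup
          (fun τ : ℝ => (((U (Y (t + τ)) - U (Y t)) / τ : ℝ) : EReal)) (𝓝[>] (0:ℝ))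
        ≤ ((-(E (Y t)) : ℝ) : EReal))
    (h0 : U (Y 0) ≤ Mh) :
    (∀ t : ℝ, 0 ≤ t → U (Y t) ≤ Mh) ∧
    Filter.limsup (fun t : ℝ => ((U (Y t) : ℝ) : EReal)) Filter.atTop
      ≤ ((Mt : ℝ) : EReal) := by
  have key : ∀ c : ℝ, Mt < c → c < Mh → ∃ e : ℝ, 0 < e ∧
      ∀ t : ℝ, 0 ≤ t → U (Y t) ≤ max c (Mh - e * t) := by
    intro c hc1 hc2
    have hcpt : IsCompact {y | c ≤ U y ∧ U y ≤ Mh} := by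
      apply Metric.isCompact_of_isClosed_isBounded
      · exact (isClosed_le continuous_const hUc).inter (isClosed_le hUc continuous_const)
      · obtain ⟨R, hR⟩ := hUp (Mh + 1)
        refine (Metric.isBounded_closedBall (x := 0) (r := R)).subset ?_
        rintro y ⟨-, hy⟩
        rw [mem_closedBall_zero_iff]
        by_contra hcon
        have := hR y (not_le.mp hcon).le
        linarith
    have hm : ∃ m : ℝ, 0 < m ∧ ∀ y, c ≤ U y → U y ≤ Mh → m ≤ E y := by
      rcases Set.eq_empty_or_nonempty {y | c ≤ U y ∧ U y ≤ Mh} with hem | hne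
      · refine ⟨1, one_pos, fun y h1 h2 => ?_⟩
        have : y ∈ {y | c ≤ U y ∧ U y ≤ Mh} := ⟨h1, h2⟩
        rw [hem] at this
        exact this.elim
      · obtain ⟨y0, hy0, hmin⟩ := hcpt.exists_isMinOn hne hEc.continuousOn
        refine ⟨E y0, hEpd.2 y0 ?_, fun y h1 h2 => hmin ⟨h1, h2⟩⟩
        rintro rfl
        have := hy0.1
        rw [hUpd.1] at this
        linarith
    obtain ⟨m, hm0, hm⟩ := hm
    refine ⟨m / 2, by positivity, fun t ht => ?_⟩
    refine fence_aux (f := fun t => U (Y t)) (B := fun t => max c (Mh - m / 2 * t)) (b := t)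
      (hUc.comp_continuousOn (hYc.mono Icc_subset_Ici_self)) (by fun_prop) ?_ ?_ t ⟨ht, le_rfl⟩
    · simp only [mul_zero, sub_zero]
      exact h0.trans (le_max_right _ _)
    · rintro x ⟨hx0, -⟩ hx
      have hcx : c ≤ U (Y x) := hx ▸ le_max_left _ _
      have hxM : U (Y x) ≤ Mh := by
        rw [hx]
        refine max_le hc2.le ?_
        have : 0 ≤ m / 2 * x := by positivity
        linarith
      have hlt := (hdec x hx0 (by linarith) hxM).trans_lt
        (show ((-(E (Y x)) : ℝ) : EReal) < ((-(m / 2) : ℝ) : EReal) by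
          rw [EReal.coe_lt_coe_iff]
          have := hm (Y x) hcx hxM
          linarith)
      have hev := Filter.eventually_lt_of_limsup_lt hlt
      have htend : Tendsto (fun z : ℝ => z - x) (𝓝[>] x) (𝓝[>] 0) := by
        refine tendsto_nhdsWithin_iff.mpr ⟨?_, ?_⟩
        · have : Tendsto (fun z : ℝ => z - x) (𝓝 x) (𝓝 (x - x)) :=
            (continuous_id.sub continuous_const).tendsto x
          rw [sub_self] at this
          exact this.mono_left nhdsWithin_le_nhds
        · filter_upwards [self_mem_nhdsWithin] with z hz
          exact sub_pos.mpr (mem_Ioi.mp hz)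
      filter_upwards [htend.eventually hev, self_mem_nhdsWithin] with z hz hzx
      have hpos : 0 < z - x := sub_pos.mpr (mem_Ioi.mp hzx)
      rw [EReal.coe_lt_coe_iff, div_lt_iff₀ hpos, add_sub_cancel] at hz
      rcases max_choice c (Mh - m / 2 * x) with h | h
      · rw [h] at hx
        refine le_trans ?_ (le_max_left _ _)
        nlinarith
      · rw [h] at hx
        refine le_trans ?_ (le_max_right _ _)
        nlinarith
  constructor
  · intro t ht
    obtain ⟨e, he, h⟩ := key ((Mt + Mh) / 2) (by linarith) (by linarith)
    refine (h t ht).trans (max_le (by linarith) ?_)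
    have : 0 ≤ e * t := by positivity
    linarith
  · refine EReal.le_of_forall_lt_iff_le.mp fun c hc => ?_
    rw [EReal.coe_lt_coe_iff] at hc
    obtain ⟨e, he, h⟩ := key (min c ((Mt + Mh) / 2)) (lt_min hc (by linarith))
      ((min_le_right _ _).trans_lt (by linarith))
    refine Filter.limsup_le_of_le (by isBoundedDefault) ?_
    filter_upwards [eventually_ge_atTop 0, eventually_ge_atTop ((Mh - c) / e)] with t h1 h2
    rw [EReal.coe_le_coe_iff]
    refine (h t h1).trans (max_le (min_le_left _ _) ?_)
    rw [div_le_iff₀ he] at h2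
    linarith
end
end
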